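/- arXiv:math/0508245 — 2 statements merged into one kernel-verified Lean document; each statement's English description precedes it below -/
import Mathlib

section
/- Let μ₁ and μ₂ be Borel probability measures on ℝ with reciprocal Cauchy transforms F_{μ₁} and F_{μ₂}. Then there exist unique functions Z₁ and Z₂ in the class 𝓕 such that for all z ∈ ℂ⁺ one has z = Z₁(z) + Z₂(z) − F_{μ₁}(Z₁(z)) and F_{μ₁}(Z₁(z)) = F_{μ₂}(Z₂(z)). -/
open MeasureTheory Complex Filter Set

/-- Open upper half-plane. -/
def upperHalf : Set ℂ := {z : ℂ | 0 < z.im}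

/-- Cauchy transform of a Borel measure on ℝ. -/
noncomputable def cauchyG (μ : Measure ℝ) (z : ℂ) : ℂ := ∫ t, (z - (t : ℂ))⁻¹ ∂μ

/-- Reciprocal Cauchy transform. -/
noncomputable def recF (μ : Measure ℝ) (z : ℂ) : ℂ := (cauchyG μ z)⁻¹

/-- The class 𝓕 of reciprocal Cauchy transforms of Borel probability measures on ℝ
(membership only depends on the values on the upper half-plane). -/
def classF (f : ℂ → ℂ) : Prop :=
  ∃ μ : Measure ℝ, IsProbabilityMeasure μ ∧ ∀ z ∈ upperHalf, f z = recF μ z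


lemma sub_ofReal_ne_zero {z : ℂ} (hz : 0 < z.im) (t : ℝ) : z - (t : ℂ) ≠ 0 := by
  intro h
  have := congrArg Complex.im h
  simp at this
  exact hz.ne' this

lemma im_le_norm_sub {z : ℂ} (hz : 0 < z.im) (t : ℝ) : z.im ≤ ‖z - (t : ℂ)‖ := by
  have := Complex.abs_im_le_norm (z - (t : ℂ))
  simp at this
  exact (le_abs_self _).trans this

lemma integrable_cauchy (μ : Measure ℝ) [IsFiniteMeasure μ] {z : ℂ} (hz : 0 < z.im) :
    Integrable (fun t : ℝ => (z - (t : ℂ))⁻¹) μ := by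
  refine Integrable.of_bound (C := z.im⁻¹) ?_ ?_
  · apply Continuous.aestronglyMeasurable
    exact Continuous.inv₀ (by fun_prop) (sub_ofReal_ne_zero hz)
  · refine Eventually.of_forall fun t => ?_
    rw [norm_inv]
    exact inv_anti₀ hz (im_le_norm_sub hz t)

lemma inv_sub_im (z : ℂ) (t : ℝ) :
    ((z - (t : ℂ))⁻¹).im = - (z.im / ‖z - (t : ℂ)‖ ^ 2) := by
  rw [Complex.inv_im, Complex.normSq_eq_norm_sq]
  simp [neg_div]

lemma integrable_pois (μ : Measure ℝ) [IsFiniteMeasure μ] {z : ℂ} (hz : 0 < z.im) :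
    Integrable (fun t : ℝ => z.im / ‖z - (t : ℂ)‖ ^ 2) μ := by
  have := (integrable_cauchy μ hz).im.neg
  refine this.congr (Eventually.of_forall fun t => ?_)
  have := inv_sub_im z t
  simp only [Pi.neg_apply]
  change - ((z - (t : ℂ))⁻¹).im = _
  rw [this, neg_neg]

lemma cauchyG_im (μ : Measure ℝ) [IsFiniteMeasure μ] {z : ℂ} (hz : 0 < z.im) :
    (cauchyG μ z).im = - ∫ t : ℝ, z.im / ‖z - (t : ℂ)‖ ^ 2 ∂μ := by
  have h := integral_im (𝕜 := ℂ) (integrable_cauchy μ hz)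
  unfold cauchyG
  change RCLike.im (∫ t : ℝ, (z - (t : ℂ))⁻¹ ∂μ) = _
  rw [← h, ← integral_neg]
  congr 1
  ext t
  exact inv_sub_im z t

lemma cauchyG_im_le (μ : Measure ℝ) [IsProbabilityMeasure μ] {z : ℂ} (hz : 0 < z.im) :
    z.im * ‖cauchyG μ z‖ ^ 2 ≤ - (cauchyG μ z).im := by
  rw [cauchyG_im μ hz, neg_neg]
  set A := ‖cauchyG μ z‖
  have h1 : A ≤ ∫ t : ℝ, ‖(z - (t : ℂ))⁻¹‖ ∂μ := norm_integral_le_integral_norm _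
  have h2 : A * A ≤ A * ∫ t : ℝ, ‖(z - (t : ℂ))⁻¹‖ ∂μ :=
    mul_le_mul_of_nonneg_left h1 (norm_nonneg _)
  have hi1 := (integrable_cauchy μ hz).norm
  have hi2 := integrable_pois μ hz
  -- pointwise `2 A x - A^2 ≤ x^2`
  have h3 : ∫ t : ℝ, z.im * (2 * A * ‖(z - (t : ℂ))⁻¹‖ - A ^ 2) ∂μ
      ≤ ∫ t : ℝ, z.im / ‖z - (t : ℂ)‖ ^ 2 ∂μ := by
    refine integral_mono (((hi1.const_mul _).sub (integrable_const _)).const_mul _) hi2 ?_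
    intro t
    simp only []
    rw [norm_inv, div_eq_mul_inv]
    refine mul_le_mul_of_nonneg_left ?_ hz.le
    rw [← inv_pow]
    nlinarith [sq_nonneg (A - ‖z - (t : ℂ)‖⁻¹)]
  rw [integral_const_mul, integral_sub (hi1.const_mul _) (integrable_const _),
    integral_const_mul, integral_const] at h3
  simp only [probReal_univ, one_smul] at h3
  refine le_trans ?_ h3
  refine mul_le_mul_of_nonneg_left ?_ hz.le
  nlinarith

lemma cauchyG_im_neg (μ : Measure ℝ) [IsProbabilityMeasure μ] {z : ℂ} (hz : 0 < z.im) :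
    (cauchyG μ z).im < 0 := by
  rw [cauchyG_im μ hz, neg_lt_zero]
  rw [integral_pos_iff_support_of_nonneg (fun t => by positivity) (integrable_pois μ hz)]
  have : Function.support (fun t : ℝ => z.im / ‖z - (t : ℂ)‖ ^ 2) = univ := by
    ext t
    simp only [Function.mem_support, mem_univ, iff_true]
    have := norm_pos_iff.2 (sub_ofReal_ne_zero hz t)
    positivity
  rw [this]
  simp

lemma cauchyG_ne_zero (μ : Measure ℝ) [IsProbabilityMeasure μ] {z : ℂ} (hz : 0 < z.im) :
    cauchyG μ z ≠ 0 := by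
  intro h
  have := cauchyG_im_neg μ hz
  simp [h] at this

lemma recF_im_ge (μ : Measure ℝ) [IsProbabilityMeasure μ] {z : ℂ} (hz : 0 < z.im) :
    z.im ≤ (recF μ z).im := by
  unfold recF
  have h0 := cauchyG_ne_zero μ hz
  rw [Complex.inv_im, Complex.normSq_eq_norm_sq, le_div_iff₀ (by positivity)]
  exact cauchyG_im_le μ hz

lemma isOpen_upperHalf : IsOpen upperHalf := by
  unfold upperHalf
  exact isOpen_lt continuous_const Complex.continuous_im

lemma cauchyG_differentiableOn (μ : Measure ℝ) [IsFiniteMeasure μ] :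
    DifferentiableOn ℂ (cauchyG μ) upperHalf := by
  intro z hz
  have h : z ∉ Set.image (algebraMap ℝ ℂ) μ.support := by
    rintro ⟨x, _, rfl⟩
    simp [upperHalf] at hz
  have h1 := (hasDerivAt_resolventTransform (μ := μ) z h).differentiableAt.neg
  have h2 : cauchyG μ = fun w => - resolventTransform μ w := by
    ext w
    unfold cauchyG
    rw [resolventTransform_apply, ← integral_neg]
    congr 1
    ext t
    simp [resolvent, ← inv_neg]
  rw [h2]
  exact h1.differentiableWithinAt

lemma recF_differentiableOn (μ : Measure ℝ) [IsProbabilityMeasure μ] :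
    DifferentiableOn ℂ (recF μ) upperHalf := by
  unfold recF
  exact (cauchyG_differentiableOn μ).inv (fun z hz => cauchyG_ne_zero μ hz)

lemma tail_tendsto (μ : Measure ℝ) [IsProbabilityMeasure μ] :
    Tendsto (fun y : ℝ => ∫ t : ℝ, |t| / (|t| + y) ∂μ) atTop (nhds 0) := by
  have : (0 : ℝ) = ∫ t : ℝ, (0 : ℝ) ∂μ := by simp
  rw [this]
  refine tendsto_integral_filter_of_dominated_convergence (fun _ => (1 : ℝ)) ?_ ?_ ?_ ?_
  · refine Eventually.of_forall fun y => ?_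
    apply Measurable.aestronglyMeasurable
    fun_prop
  · filter_upwards [eventually_gt_atTop 0] with y hy
    refine Eventually.of_forall fun t => ?_
    have : 0 < |t| + y := by positivity
    rw [Real.norm_eq_abs, abs_of_nonneg (by positivity), div_le_one this]
    linarith
  · exact integrable_const _
  · refine Eventually.of_forall fun t => ?_
    refine Tendsto.div_atTop tendsto_const_nhds ?_
    exact tendsto_atTop_add_const_left _ _ tendsto_id

lemma cauchyG_asymp_bound (μ : Measure ℝ) [IsProbabilityMeasure μ] {y : ℝ} (hy : 0 < y) {w : ℂ}
    (hw : ‖w - y * I‖ ≤ y / 2) :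
    0 < w.im ∧ ‖w‖ ≤ 2 * y ∧
      ‖w * cauchyG μ w - 1‖ ≤ 6 * ∫ t : ℝ, |t| / (|t| + y) ∂μ := by
  have h1 : |(w - y * I).im| ≤ y / 2 := (Complex.abs_im_le_norm _).trans hw
  simp at h1
  have him : y / 2 ≤ w.im := by
    have := (abs_le.1 h1).1
    linarith
  have hpos : 0 < w.im := by linarith
  have hn : ‖w‖ ≤ 3 / 2 * y := by
    have := norm_add_le (w - y * I) (y * I)
    simp [abs_of_pos hy] at this
    linarith
  refine ⟨hpos, by linarith, ?_⟩
  have hi := integrable_cauchy μ hpos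
  have e : w * cauchyG μ w - 1 = ∫ t : ℝ, (t : ℂ) * (w - (t : ℂ))⁻¹ ∂μ := by
    unfold cauchyG
    rw [← integral_const_mul]
    have : (1 : ℂ) = ∫ t : ℝ, (1 : ℂ) ∂μ := by simp
    rw [this, ← integral_sub (hi.const_mul _) (integrable_const _)]
    congr 1
    ext t
    have := sub_ofReal_ne_zero hpos t
    field_simp
    ring
  rw [e, ← integral_const_mul]
  refine norm_integral_le_of_norm_le ?_ ?_
  · refine Integrable.const_mul ?_ _
    refine Integrable.of_bound (C := 1) ?_ ?_
    · apply Measurable.aestronglyMeasurable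
      fun_prop
    · refine Eventually.of_forall fun t => ?_
      have : 0 < |t| + y := by positivity
      rw [Real.norm_eq_abs, abs_of_nonneg (by positivity), div_le_one this]
      linarith
  · refine Eventually.of_forall fun t => ?_
    have a1 := im_le_norm_sub hpos t
    have a2 : |t| ≤ ‖w - (t : ℂ)‖ + ‖w‖ := by
      have := norm_sub_le w (w - (t : ℂ))
      simp at this
      linarith
    have a3 : |t| + y ≤ 6 * ‖w - (t : ℂ)‖ := by linarith
    have a4 : 0 < ‖w - (t : ℂ)‖ := by linarith
    rw [norm_mul, norm_inv, Complex.norm_real, Real.norm_eq_abs, ← div_eq_mul_inv,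
      div_le_iff₀ a4]
    have a5 : 0 < |t| + y := by positivity
    have : 6 * (|t| / (|t| + y)) * ‖w - (t : ℂ)‖ = |t| * ((6 * ‖w - (t : ℂ)‖) / (|t| + y)) := by
      ring
    rw [this]
    refine le_mul_of_one_le_right (abs_nonneg _) ?_
    rwa [one_le_div a5]

lemma recF_asymp (μ : Measure ℝ) [IsProbabilityMeasure μ] {δ : ℝ} (hδ : 0 < δ) :
    ∃ Y > (0 : ℝ), ∀ y ≥ Y, ∀ w : ℂ, ‖w - y * I‖ ≤ y / 2 → ‖recF μ w - w‖ ≤ δ * y := by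
  set η := min (1 / 2) (δ / 4) with hη
  have hηpos : 0 < η := by positivity
  have h := (tail_tendsto μ).eventually (gt_mem_nhds (show (0 : ℝ) < η / 6 by positivity))
  obtain ⟨Y, hY⟩ := eventually_atTop.1 h
  refine ⟨max Y 1, by positivity, fun y hy w hw => ?_⟩
  have hy0 : 0 < y := lt_of_lt_of_le (by positivity) hy
  obtain ⟨him, hn, hb⟩ := cauchyG_asymp_bound μ hy0 hw
  have h6 : ‖w * cauchyG μ w - 1‖ ≤ η := by
    have := hY y ((le_max_left _ _).trans hy)
    linarith
  set G := cauchyG μ w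
  have hG : G ≠ 0 := cauchyG_ne_zero μ him
  have hlow : 1 / 2 ≤ ‖w * G‖ := by
    have := norm_sub_le (w * G) (w * G - 1)
    rw [sub_sub_cancel, norm_one] at this
    have : η ≤ 1 / 2 := min_le_left _ _
    linarith
  have hw0 : w ≠ 0 := by
    rintro rfl
    simp at him
  have e : recF μ w - w = - w * (w * G - 1) / (w * G) := by
    change G⁻¹ - w = _
    field_simp
    ring
  rw [e, norm_div, norm_mul, norm_neg, div_le_iff₀ (by positivity)]
  have hη2 : η ≤ δ / 4 := min_le_right _ _
  calc ‖w‖ * ‖w * G - 1‖ ≤ (2 * y) * (δ / 4) :=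
        mul_le_mul hn (h6.trans hη2) (norm_nonneg _) (by positivity)
    _ = δ * y * (1 / 2) := by ring
    _ ≤ _ := mul_le_mul_of_nonneg_left hlow (by positivity)

lemma cauchyG_iy_tendsto (μ : Measure ℝ) [IsProbabilityMeasure μ] :
    Tendsto (fun y : ℝ => (y * I : ℂ) * cauchyG μ (y * I)) atTop (nhds 1) := by
  rw [tendsto_iff_norm_sub_tendsto_zero]
  have h := (tail_tendsto μ).const_mul 6
  simp only [mul_zero] at h
  refine squeeze_zero' (Eventually.of_forall fun _ => norm_nonneg _) ?_ h
  filter_upwards [eventually_gt_atTop 0] with y hy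
  exact (cauchyG_asymp_bound μ hy (by simp; positivity)).2.2

/-! Schwarz-Pick -/

lemma im_pos_of_disc {w : ℂ} (hw : 0 < w.im) {ζ : ℂ} (hζ : ‖ζ‖ < 1) :
    0 < ((w - (starRingEnd ℂ) w * ζ) / (1 - ζ)).im := by
  have h1 : (1 : ℂ) - ζ ≠ 0 := by
    intro h
    have : ζ = 1 := (sub_eq_zero.1 h).symm
    simp [this] at hζ
  have h2 : 0 < normSq (1 - ζ) := Complex.normSq_pos.2 h1
  have h3 : normSq ζ < 1 := by
    rw [Complex.normSq_eq_norm_sq]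
    nlinarith [norm_nonneg ζ]
  rw [Complex.normSq_apply] at h3
  have : ((w - (starRingEnd ℂ) w * ζ) / (1 - ζ)).im
      = w.im * (1 - (ζ.re * ζ.re + ζ.im * ζ.im)) / normSq (1 - ζ) := by
    rw [Complex.div_im, ← sub_div]
    congr 1
    simp
    ring
  rw [this]
  apply div_pos (mul_pos hw (by linarith)) h2

lemma sub_conj_ne_zero {z w : ℂ} (hz : 0 < z.im) (hw : 0 < w.im) :
    z - (starRingEnd ℂ) w ≠ 0 := by
  intro h
  have := congrArg Complex.im h
  simp at this
  linarith

lemma norm_sub_lt_conj {z w : ℂ} (hz : 0 < z.im) (hw : 0 < w.im) :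
    ‖z - w‖ < ‖z - (starRingEnd ℂ) w‖ := by
  refine lt_of_pow_lt_pow_left₀ 2 (norm_nonneg _) ?_
  rw [← Complex.normSq_eq_norm_sq, ← Complex.normSq_eq_norm_sq, Complex.normSq_apply,
    Complex.normSq_apply]
  simp
  nlinarith [mul_pos hz hw]

/-- Schwarz-Pick inequality in the upper half-plane. -/
lemma schwarz_pick {f : ℂ → ℂ} (hf : DifferentiableOn ℂ f upperHalf)
    (hm : ∀ z ∈ upperHalf, 0 < (f z).im) {z w : ℂ} (hz : 0 < z.im) (hw : 0 < w.im) :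
    ‖f z - f w‖ / ‖f z - (starRingEnd ℂ) (f w)‖ ≤ ‖z - w‖ / ‖z - (starRingEnd ℂ) w‖ := by
  let φ : ℂ → ℂ := fun ζ => (w - (starRingEnd ℂ) w * ζ) / (1 - ζ)
  have hφ1 : ∀ ζ ∈ Metric.ball (0 : ℂ) 1, (1 : ℂ) - ζ ≠ 0 := by
    intro ζ hζ h
    have : ζ = 1 := (sub_eq_zero.1 h).symm
    simp [this] at hζ
  have hφm : MapsTo φ (Metric.ball (0 : ℂ) 1) upperHalf := by
    intro ζ hζ
    exact im_pos_of_disc hw (by simpa using hζ)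
  have hφd : DifferentiableOn ℂ φ (Metric.ball (0 : ℂ) 1) := by
    refine DifferentiableOn.div (by fun_prop) (by fun_prop) hφ1
  have hfφ : DifferentiableOn ℂ (fun ζ => f (φ ζ)) (Metric.ball (0 : ℂ) 1) :=
    hf.comp hφd hφm
  let g : ℂ → ℂ := fun ζ => (f (φ ζ) - f w) / (f (φ ζ) - (starRingEnd ℂ) (f w))
  have hgd : DifferentiableOn ℂ g (Metric.ball (0 : ℂ) 1) := by
    refine DifferentiableOn.div (hfφ.sub_const _) (hfφ.sub_const _) ?_
    intro ζ hζ
    exact sub_conj_ne_zero (hm _ (hφm hζ)) (hm w hw)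
  have hgm : MapsTo g (Metric.ball (0 : ℂ) 1) (Metric.closedBall 0 1) := by
    intro ζ hζ
    have := norm_sub_lt_conj (hm _ (hφm hζ)) (hm w hw)
    simp only [mem_closedBall_zero_iff, g, norm_div]
    exact div_le_one_of_le₀ this.le (norm_nonneg _)
  have hg0 : g 0 = 0 := by simp [g, φ]
  set ζ := (z - w) / (z - (starRingEnd ℂ) w) with hζdef
  have hne := sub_conj_ne_zero hz hw
  have hζ : ‖ζ‖ < 1 := by
    rw [hζdef, norm_div, div_lt_one (norm_pos_iff.2 hne)]
    exact norm_sub_lt_conj hz hw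
  have hφζ : φ ζ = z := by
    have h1 := hφ1 ζ (by simpa using hζ)
    simp only [φ]
    rw [div_eq_iff h1, hζdef]
    field_simp
    ring
  have := Complex.norm_le_norm_of_mapsTo_ball hgd hgm hg0 hζ
  simp only [g, hφζ, norm_div] at this
  rw [hζdef, norm_div] at this
  exact this

/-! Iteration -/

/-- One step of contraction. -/
lemma contraction_step {f : ℂ → ℂ} {y : ℝ} (hy : 0 < y) (hf : DifferentiableOn ℂ f upperHalf)
    (hm : ∀ z ∈ upperHalf, y ≤ (f z).im) {a b : ℂ} (ha : 0 < a.im) (hb : 0 < b.im) :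
    ‖f a - f b‖ / ‖f a - (starRingEnd ℂ) (f b) - y * I‖ ≤ ‖a - b‖ / ‖a - (starRingEnd ℂ) b‖ := by
  have h := schwarz_pick (f := fun z => f z - (y / 2 : ℝ) * I) (hf.sub_const _)
    (fun z hz => by
      have := hm z hz
      simp
      linarith) ha hb
  convert h using 3
  · ring
  · rw [map_sub, map_mul, Complex.conj_I, Complex.conj_ofReal]
    push_cast
    ring

/-- Uniqueness of fixed points. -/
lemma fixed_unique {f : ℂ → ℂ} {y : ℝ} (hy : 0 < y) (hf : DifferentiableOn ℂ f upperHalf)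
    (hm : ∀ z ∈ upperHalf, y ≤ (f z).im) {a b : ℂ} (ha : 0 < a.im) (hb : 0 < b.im)
    (hfa : f a = a) (hfb : f b = b) : a = b := by
  by_contra hab
  have h := contraction_step hy hf hm ha hb
  rw [hfa, hfb] at h
  have ha' : y ≤ a.im := hfa ▸ hm a ha
  have hb' : y ≤ b.im := hfb ▸ hm b hb
  have hpos : 0 < ‖a - b‖ := norm_pos_iff.2 (sub_ne_zero.2 hab)
  have h1 : 0 < ‖a - (starRingEnd ℂ) b - y * I‖ := by
    rw [norm_pos_iff]
    intro h0
    have := congrArg Complex.im h0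
    simp at this
    linarith
  have h2 : ‖a - (starRingEnd ℂ) b - y * I‖ < ‖a - (starRingEnd ℂ) b‖ := by
    refine lt_of_pow_lt_pow_left₀ 2 (norm_nonneg _) ?_
    rw [← Complex.normSq_eq_norm_sq, ← Complex.normSq_eq_norm_sq, Complex.normSq_apply,
      Complex.normSq_apply]
    simp
    nlinarith
  have := div_lt_div_of_pos_left hpos h1 h2
  linarith

/-- quantitative contraction: `a, b` bounded by `R`. -/
lemma quant_contraction {f : ℂ → ℂ} {y R : ℝ} (hy : 0 < y)
    (hf : DifferentiableOn ℂ f upperHalf)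
    (hm : ∀ z ∈ upperHalf, y ≤ (f z).im) {a b : ℂ} (ha : 0 < a.im) (hb : 0 < b.im)
    (hR : ‖f a‖ ≤ R) (hR' : ‖f b‖ ≤ R) :
    ‖f a - f b‖ / ‖f a - (starRingEnd ℂ) (f b)‖
      ≤ √(1 - y ^ 2 / (4 * R ^ 2)) * (‖a - b‖ / ‖a - (starRingEnd ℂ) b‖) := by
  have h := contraction_step hy hf hm ha hb
  have ha' : y ≤ (f a).im := hm a ha
  have hb' : y ≤ (f b).im := hm b hb
  set A := f a
  set B := f b
  have hRy : y ≤ R := ha'.trans ((Complex.im_le_norm A).trans hR)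
  have h1 : 0 < ‖A - (starRingEnd ℂ) B - y * I‖ := by
    rw [norm_pos_iff]
    intro h0
    have := congrArg Complex.im h0
    simp at this
    linarith
  have h0 : 0 < ‖A - (starRingEnd ℂ) B‖ := by
    rw [norm_pos_iff]
    exact sub_conj_ne_zero (by linarith) (by linarith)
  have hle : ‖A - (starRingEnd ℂ) B‖ ≤ 2 * R := by
    have := norm_sub_le A ((starRingEnd ℂ) B)
    simp at this
    linarith
  have hq : 0 ≤ 1 - y ^ 2 / (4 * R ^ 2) := by
    have hR0 : 0 < R := hy.trans_le hRy
    rw [sub_nonneg, div_le_one (by positivity)]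
    nlinarith
  have h2 : ‖A - (starRingEnd ℂ) B - y * I‖
      ≤ √(1 - y ^ 2 / (4 * R ^ 2)) * ‖A - (starRingEnd ℂ) B‖ := by
    have hR0 : 0 < R := hy.trans_le hRy
    refine (sq_le_sq₀ (norm_nonneg _) (by positivity)).1 ?_
    rw [mul_pow, Real.sq_sqrt hq]
    have e1 : ‖A - (starRingEnd ℂ) B - y * I‖ ^ 2
      = ‖A - (starRingEnd ℂ) B‖ ^ 2 - 2 * y * (A.im + B.im) + y ^ 2 := by
      rw [← Complex.normSq_eq_norm_sq, ← Complex.normSq_eq_norm_sq, Complex.normSq_apply,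
        Complex.normSq_apply]
      simp
      ring
    have e2 : y ^ 2 / (4 * R ^ 2) * ‖A - (starRingEnd ℂ) B‖ ^ 2 ≤ y ^ 2 := by
      rw [div_mul_eq_mul_div, div_le_iff₀ (by positivity)]
      refine mul_le_mul_of_nonneg_left ?_ (by positivity)
      nlinarith
    rw [e1]
    nlinarith
  calc ‖A - B‖ / ‖A - (starRingEnd ℂ) B‖
      = (‖A - (starRingEnd ℂ) B - y * I‖ / ‖A - (starRingEnd ℂ) B‖)
        * (‖A - B‖ / ‖A - (starRingEnd ℂ) B - y * I‖) := by
        field_simp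
    _ ≤ _ := by
        refine mul_le_mul ?_ h (by positivity) (by positivity)
        rwa [div_le_iff₀ h0]

/-- geometric estimate on orbits. -/
lemma orbit_geometric {f : ℂ → ℂ} {y R : ℝ} (hy : 0 < y)
    (hf : DifferentiableOn ℂ f upperHalf)
    (hm : ∀ z ∈ upperHalf, y ≤ (f z).im) {a : ℂ} (ha : 0 < a.im)
    (hR : ∀ n, ‖f^[n] a‖ ≤ R) (n : ℕ) :
    dist (f^[n] a) (f^[n + 1] a) ≤ 2 * R * √(1 - y ^ 2 / (4 * R ^ 2)) ^ n := by
  have him : ∀ n, 0 < (f^[n] a).im := by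
    intro n
    induction n with
    | zero => simpa using ha
    | succ k ih =>
      rw [Function.iterate_succ_apply']
      exact hy.trans_le (hm _ ih)
  have key : ∀ n, ‖f^[n] a - f^[n+1] a‖ / ‖f^[n] a - (starRingEnd ℂ) (f^[n+1] a)‖
      ≤ √(1 - y ^ 2 / (4 * R ^ 2)) ^ n := by
    intro n
    induction n with
    | zero =>
      rw [pow_zero]
      exact div_le_one_of_le₀ (norm_sub_lt_conj (him 0) (him 1)).le (norm_nonneg _)
    | succ k ih =>
      rw [pow_succ', Function.iterate_succ_apply' f k a, Function.iterate_succ_apply' f (k+1) a]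
      refine (quant_contraction (R := R) hy hf hm (him k) (him (k+1)) ?_ ?_).trans ?_
      · rw [← Function.iterate_succ_apply' f k a]
        exact hR _
      · rw [← Function.iterate_succ_apply' f (k+1) a]
        exact hR _
      · exact mul_le_mul_of_nonneg_left ih (Real.sqrt_nonneg _)
  have h0 : 0 < ‖f^[n] a - (starRingEnd ℂ) (f^[n+1] a)‖ :=
    norm_pos_iff.2 (sub_conj_ne_zero (him n) (him (n+1)))
  have h1 := key n
  rw [div_le_iff₀ h0] at h1
  rw [dist_eq_norm]
  refine h1.trans ?_
  rw [mul_comm]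
  refine mul_le_mul_of_nonneg_right ?_ (by positivity)
  have := norm_sub_le (f^[n] a) ((starRingEnd ℂ) (f^[n+1] a))
  simp only [RCLike.norm_conj] at this
  linarith [hR n, hR (n+1)]

lemma sqrt_lt_one_aux {y R : ℝ} (hy : 0 < y) (hR : 0 < R) : √(1 - y ^ 2 / (4 * R ^ 2)) < 1 := by
  rw [Real.sqrt_lt' one_pos]
  have : 0 < y ^ 2 / (4 * R ^ 2) := by positivity
  linarith

/-- The asymptotic condition `h(w) = o(|w|)` nontangentially. -/
def SmallAtInf (h : ℂ → ℂ) : Prop :=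
  ∀ δ > (0 : ℝ), ∃ Y > (0 : ℝ), ∀ y ≥ Y, ∀ w : ℂ, ‖w - y * I‖ ≤ y / 2 → ‖h w‖ ≤ δ * y

lemma exists_fixed (h₁ h₂ : ℂ → ℂ) (hd₁ : DifferentiableOn ℂ h₁ upperHalf)
    (hd₂ : DifferentiableOn ℂ h₂ upperHalf)
    (hi₁ : ∀ z ∈ upperHalf, 0 ≤ (h₁ z).im) (hi₂ : ∀ z ∈ upperHalf, 0 ≤ (h₂ z).im)
    (hs₁ : SmallAtInf h₁) (hs₂ : SmallAtInf h₂) :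
    ∃ Z : ℂ → ℂ, DifferentiableOn ℂ Z upperHalf ∧ (∀ z ∈ upperHalf, z.im ≤ (Z z).im) ∧
      (∀ z ∈ upperHalf, Z z = z + h₂ (z + h₁ (Z z))) ∧
      ∀ δ > (0 : ℝ), ∃ Y > (0 : ℝ), ∀ y ≥ Y, ‖Z (y * I) - y * I‖ ≤ δ * y := by
  let f : ℂ → ℂ → ℂ := fun z w => z + h₂ (z + h₁ w)
  have hmid : ∀ z ∈ upperHalf, ∀ w ∈ upperHalf, z + h₁ w ∈ upperHalf := by
    intro z hz w hw
    have := hi₁ w hw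
    simp only [upperHalf, mem_ofPred_eq, add_im] at hz ⊢
    linarith
  have hfd : ∀ z ∈ upperHalf, DifferentiableOn ℂ (f z) upperHalf := by
    intro z hz
    have h := hd₂.comp (hd₁.const_add z) (fun w hw => hmid z hz w hw)
    exact h.const_add z
  have hfm : ∀ z ∈ upperHalf, ∀ w ∈ upperHalf, z.im ≤ (f z w).im := by
    intro z hz w hw
    have := hi₂ _ (hmid z hz w hw)
    simp only [f, add_im] at this ⊢
    linarith
  let g : ℕ → ℂ → ℂ := fun n z => (f z)^[n] z
  have hgs : ∀ n z, g (n + 1) z = f z (g n z) := by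
    intro n z
    exact Function.iterate_succ_apply' _ _ _
  have hgim : ∀ n, ∀ z ∈ upperHalf, z.im ≤ (g n z).im := by
    intro n
    induction n with
    | zero => intro z hz; exact le_rfl
    | succ k ih =>
      intro z hz
      rw [hgs]
      exact hfm z hz _ (lt_of_lt_of_le hz (ih z hz))
  have hgU : ∀ n, ∀ z ∈ upperHalf, g n z ∈ upperHalf := fun n z hz =>
    lt_of_lt_of_le hz (hgim n z hz)
  have hgd : ∀ n, DifferentiableOn ℂ (g n) upperHalf := by
    intro n
    induction n with
    | zero => exact differentiableOn_id
    | succ k ih =>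
      have : g (k + 1) = fun z => z + h₂ (z + h₁ (g k z)) := by
        ext z
        exact hgs k z
      rw [this]
      refine differentiableOn_id.add ?_
      refine hd₂.comp (differentiableOn_id.add (hd₁.comp ih (hgU k))) ?_
      intro z hz
      exact hmid z hz _ (hgU k z hz)
  -- invariance of the balls at infinity
  have hinv : ∀ δ > (0 : ℝ), ∃ Y > (0 : ℝ), ∀ y ≥ Y, ∀ n, ‖g n (y * I) - y * I‖ ≤ δ * y := by
    intro δ hδ
    set η := min δ (1 / 2) with hη
    have hηp : 0 < η := by positivity
    obtain ⟨Y₁, hY₁, H₁⟩ := hs₁ η hηp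
    obtain ⟨Y₂, hY₂, H₂⟩ := hs₂ η hηp
    refine ⟨max Y₁ Y₂, by positivity, fun y hy n => ?_⟩
    have hy0 : 0 < y := lt_of_lt_of_le (by positivity) hy
    have hy1 : η * y ≤ y / 2 := by
      have : η ≤ 1 / 2 := min_le_right _ _
      nlinarith
    suffices h : ‖g n (y * I) - y * I‖ ≤ η * y from
      h.trans (mul_le_mul_of_nonneg_right (min_le_left _ _) hy0.le)
    induction n with
    | zero =>
      simp [g]
      positivity
    | succ k ih =>
      rw [hgs]
      have a := H₁ y ((le_max_left _ _).trans hy) _ (ih.trans hy1)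
      have b := H₂ y ((le_max_right _ _).trans hy) (y * I + h₁ (g k (y * I)))
        (by rw [add_sub_cancel_left]; exact a.trans hy1)
      simp only [f]
      rwa [add_sub_cancel_left]
  -- local bounds
  obtain ⟨y₀, hy₀, Hy₀⟩ := hinv 1 one_pos
  set p : ℂ := y₀ * I with hp
  have hpU : p ∈ upperHalf := by simp [upperHalf, hp]; exact hy₀
  have hgp : ∀ n, ‖g n p‖ ≤ 2 * y₀ := by
    intro n
    have := Hy₀ y₀ le_rfl n
    have h2 := norm_add_le (g n p - p) p
    have h3 : ‖p‖ = y₀ := by simp [hp, abs_of_pos hy₀]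
    rw [sub_add_cancel] at h2
    linarith
  let r : ℂ → ℝ := fun z => ‖z - p‖ / ‖z - (starRingEnd ℂ) p‖
  let B : ℂ → ℝ := fun z => 2 * y₀ + 4 * y₀ * r z / (1 - r z)
  have hr1 : ∀ z ∈ upperHalf, r z < 1 := by
    intro z hz
    rw [div_lt_one (norm_pos_iff.2 (sub_conj_ne_zero hz hpU))]
    exact norm_sub_lt_conj hz hpU
  have hBcont : ContinuousOn B upperHalf := by
    have hrc : ContinuousOn r upperHalf := by
      refine ContinuousOn.div (by fun_prop) (by fun_prop) ?_
      intro z hz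
      exact (norm_pos_iff.2 (sub_conj_ne_zero hz hpU)).ne'
    refine continuousOn_const.add (ContinuousOn.div (continuousOn_const.mul hrc)
      (continuousOn_const.sub hrc) ?_)
    intro z hz
    have := hr1 z hz
    linarith
  have hgB : ∀ n, ∀ z ∈ upperHalf, ‖g n z‖ ≤ B z := by
    intro n z hz
    have hsp := schwarz_pick (hgd n) (fun z hz => hgU n z hz) hz hpU
    have hne := norm_pos_iff.2 (sub_conj_ne_zero (hgU n z hz) (hgU n p hpU))
    have hr := hr1 z hz
    change _ ≤ r z at hsp
    rw [div_le_iff₀ hne] at hsp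
    set a := g n z
    set b := g n p
    have h1 : ‖a - (starRingEnd ℂ) b‖ ≤ ‖a - b‖ + 2 * ‖b‖ := by
      have e : a - (starRingEnd ℂ) b = (a - b) + (b - (starRingEnd ℂ) b) := by ring
      rw [e]
      refine (norm_add_le _ _).trans ?_
      have := norm_sub_le b ((starRingEnd ℂ) b)
      simp only [RCLike.norm_conj] at this
      linarith
    have hb := hgp n
    have hr0 : 0 ≤ r z := by positivity
    have h2 : ‖a - b‖ ≤ 4 * y₀ * r z / (1 - r z) := by
      rw [le_div_iff₀ (by linarith)]
      nlinarith [mul_le_mul_of_nonneg_left h1 hr0, mul_le_mul_of_nonneg_left hb hr0]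
    have h3 := norm_add_le (a - b) b
    rw [sub_add_cancel] at h3
    simp only [B]
    linarith
  -- pointwise convergence
  have hgeo : ∀ z ∈ upperHalf, ∀ y R : ℝ, 0 < y → y ≤ z.im → B z ≤ R → ∀ n,
      dist (g n z) (g (n + 1) z) ≤ 2 * R * √(1 - y ^ 2 / (4 * R ^ 2)) ^ n := by
    intro z hz y R hy hyz hBR n
    exact orbit_geometric hy (hfd z hz) (fun w hw => hyz.trans (hfm z hz w hw)) hz
      (fun n => (hgB n z hz).trans hBR) n
  have hBpos : ∀ z ∈ upperHalf, 0 < B z := by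
    intro z hz
    have h1 := hgB 0 z hz
    refine lt_of_lt_of_le ?_ h1
    refine lt_of_lt_of_le ?_ (Complex.im_le_norm _)
    exact hgU 0 z hz
  have hlim : ∀ z ∈ upperHalf, ∃ l, Tendsto (fun n => g n z) atTop (nhds l) := by
    intro z hz
    have hc := cauchySeq_of_le_geometric _ _ (sqrt_lt_one_aux (y := z.im) (R := B z) hz (hBpos z hz))
      (hgeo z hz z.im (B z) hz le_rfl le_rfl)
    exact cauchySeq_tendsto_of_complete hc
  choose! Z hZ using hlim
  have hZim : ∀ z ∈ upperHalf, z.im ≤ (Z z).im := by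
    intro z hz
    have := (Complex.continuous_im.tendsto _).comp (hZ z hz)
    exact ge_of_tendsto' this (fun n => hgim n z hz)
  have hZU : ∀ z ∈ upperHalf, Z z ∈ upperHalf := fun z hz => lt_of_lt_of_le hz (hZim z hz)
  refine ⟨Z, ?_, hZim, ?_, ?_⟩
  · have hloc : TendstoLocallyUniformlyOn g Z atTop upperHalf := by
      rw [tendstoLocallyUniformlyOn_iff_forall_tendsto]
      intro z₀ hz₀
      -- uniform constants near `z₀`
      set y := z₀.im / 2 with hy
      have hz₀' : 0 < z₀.im := hz₀
      have hy0 : 0 < y := by positivity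
      set R := B z₀ + 1 with hR
      have hR0 : 0 < R := by have := hBpos z₀ hz₀; linarith
      have e1 : ∀ᶠ z in nhdsWithin z₀ upperHalf, B z < R :=
        (hBcont z₀ hz₀).eventually (gt_mem_nhds (by linarith))
      have e2 : ∀ᶠ z in nhdsWithin z₀ upperHalf, y < z.im :=
        (Complex.continuous_im.continuousWithinAt).eventually (lt_mem_nhds (by linarith))
      set q := √(1 - y ^ 2 / (4 * R ^ 2)) with hq
      have hq1 : q < 1 := sqrt_lt_one_aux hy0 hR0
      have hbound : ∀ᶠ z in nhdsWithin z₀ upperHalf, ∀ n,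
          dist (g n z) (Z z) ≤ 2 * R * q ^ n / (1 - q) := by
        filter_upwards [e1, e2, self_mem_nhdsWithin] with z h1 h2 h3 n
        exact dist_le_of_le_geometric_of_tendsto q (2 * R) hq1
          (hgeo z h3 y R hy0 h2.le h1.le) (hZ z h3) n
      have hq0 : Tendsto (fun n : ℕ => 2 * R * q ^ n / (1 - q)) atTop (nhds 0) := by
        have := ((tendsto_pow_atTop_nhds_zero_of_lt_one (Real.sqrt_nonneg _) hq1).const_mul
          (2 * R)).div_const (1 - q)
        simpa using this
      rw [tendsto_uniformity_iff_dist_tendsto_zero]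
      rw [Metric.tendsto_nhds]
      intro ε hε
      have e3 := hq0.eventually (gt_mem_nhds hε)
      filter_upwards [e3.prod_mk hbound] with x hx
      have := hx.2 x.1
      rw [Real.dist_eq, sub_zero, abs_of_nonneg dist_nonneg, dist_comm]
      exact this.trans_lt hx.1
    exact hloc.differentiableOn (Eventually.of_forall hgd) isOpen_upperHalf
  · intro z hz
    have h1 := (hZ z hz).comp (tendsto_add_atTop_nat 1)
    have hc : ContinuousAt (f z) (Z z) :=
      ((hfd z hz).differentiableAt (isOpen_upperHalf.mem_nhds (hZU z hz))).continuousAt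
    have h2 := hc.tendsto.comp (hZ z hz)
    refine tendsto_nhds_unique h1 (h2.congr fun n => ?_)
    exact (hgs n z).symm
  · intro δ hδ
    obtain ⟨Y, hY, H⟩ := hinv δ hδ
    refine ⟨Y, hY, fun y hy => ?_⟩
    have hyU : (y * I : ℂ) ∈ upperHalf := by
      simp [upperHalf]
      exact lt_of_lt_of_le hY hy
    have := ((hZ _ hyU).sub_const (y * I)).norm
    exact le_of_tendsto' this (fun n => H y hy n)

/-! Herglotz representation in the disc -/

lemma continuous_pois_circle {w : ℂ} (hw : w ∈ Metric.ball (0 : ℂ) 1) :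
    Continuous (fun θ : ℝ => poissonKernel 0 w (circleMap 0 1 θ)) := by
  simp only [poissonKernel_def]
  refine Continuous.div (by fun_prop) (by fun_prop) ?_
  intro θ h
  have h1 : circleMap 0 1 θ = w := by
    have : ‖circleMap 0 1 θ - 0 - (w - 0)‖ = 0 := by simpa using h
    simpa [sub_eq_zero] using this
  rw [← h1] at hw
  simp at hw

lemma pois_circle_bound {w : ℂ} (hw : w ∈ Metric.ball (0 : ℂ) 1) (θ : ℝ) :
    ‖poissonKernel 0 w (circleMap 0 1 θ)‖ ≤ 1 / (1 - ‖w‖) ^ 2 := by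
  have hw' : ‖w‖ < 1 := by simpa using hw
  simp only [poissonKernel_def, sub_zero]
  have h1 : ‖circleMap 0 1 θ‖ = 1 := by simp
  have h2 : 1 - ‖w‖ ≤ ‖circleMap 0 1 θ - w‖ := by
    have := norm_sub_norm_le (circleMap 0 1 θ) w
    rwa [h1] at this
  rw [h1]
  have h3 : 0 < 1 - ‖w‖ := by linarith
  have h4 : 0 ≤ 1 ^ 2 - ‖w‖ ^ 2 := by nlinarith [norm_nonneg w]
  rw [Real.norm_eq_abs, abs_of_nonneg (by positivity)]
  refine div_le_div₀ (by positivity) ?_ (by positivity) ?_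
  · nlinarith [norm_nonneg w]
  · exact pow_le_pow_left₀ h3.le h2 2

/-- The approximating measures. -/
noncomputable def apx (g : ℂ → ℂ) (r : ℝ) : Measure ℝ :=
  (volume.restrict (Ioc 0 (2 * Real.pi))).withDensity
    (fun θ => ENNReal.ofReal ((g (r * circleMap 0 1 θ)).re / (2 * Real.pi)))

lemma apx_dens_cont {g : ℂ → ℂ} (hg : DifferentiableOn ℂ g (Metric.ball 0 1)) {r : ℝ}
    (hr0 : 0 < r) (hr1 : r < 1) :
    Continuous (fun θ : ℝ => g (r * circleMap 0 1 θ)) := by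
  refine hg.continuousOn.comp_continuous (by fun_prop) ?_
  intro θ
  simp [abs_of_pos hr0, hr1]

lemma apx_integral {g : ℂ → ℂ} (hg : DifferentiableOn ℂ g (Metric.ball 0 1))
    (hpos : ∀ w ∈ Metric.ball (0 : ℂ) 1, 0 ≤ (g w).re) {r : ℝ}
    (hr0 : 0 < r) (hr1 : r < 1) {w : ℂ} (hw : w ∈ Metric.ball (0 : ℂ) 1) :
    ∫ θ, poissonKernel 0 w (circleMap 0 1 θ) ∂(apx g r) = (g (r * w)).re := by
  have hmaps : ∀ ζ ∈ Metric.closedBall (0 : ℂ) 1, (r : ℂ) * ζ ∈ Metric.ball (0 : ℂ) 1 := by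
    intro ζ hζ
    simp only [Metric.mem_closedBall, dist_zero_right] at hζ
    simp only [Metric.mem_ball, dist_zero_right, norm_mul, Complex.norm_real, Real.norm_eq_abs,
      abs_of_pos hr0]
    nlinarith [norm_nonneg ζ]
  have hd : DiffContOnCl ℂ (fun ζ => g (r * ζ)) (Metric.ball 0 1) := by
    apply DifferentiableOn.diffContOnCl
    rw [closure_ball _ one_ne_zero]
    exact hg.comp (by fun_prop) hmaps
  have hP := hd.circleAverage_poissonKernel_smul hw
  have hcd := apx_dens_cont hg hr0 hr1
  have hcp := continuous_pois_circle hw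
  have hre := congrArg Complex.re hP
  rw [← hre]
  unfold Real.circleAverage
  rw [Complex.real_smul, Complex.re_ofReal_mul]
  have h1 : (∫ θ in (0)..(2 * Real.pi),
        (poissonKernel 0 w • fun ζ => g (r * ζ)) (circleMap 0 1 θ)).re
      = ∫ θ in (0)..(2 * Real.pi),
        ((poissonKernel 0 w • fun ζ => g (r * ζ)) (circleMap 0 1 θ)).re := by
    have := ContinuousLinearMap.intervalIntegral_comp_comm (μ := volume) (a := 0)
      (b := 2 * Real.pi) Complex.reCLM
      (f := fun θ => (poissonKernel 0 w • fun ζ => g (r * ζ)) (circleMap 0 1 θ)) ?_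
    · exact this.symm
    · apply Continuous.intervalIntegrable
      exact hcp.smul hcd
  rw [h1, intervalIntegral.integral_of_le (by positivity)]
  unfold apx
  rw [integral_withDensity_eq_integral_toReal_smul, ← integral_const_mul]
  · congr 1
    ext θ
    have hnn : 0 ≤ (g (r * circleMap 0 1 θ)).re := hpos _ (hmaps _ (by simp))
    rw [ENNReal.toReal_ofReal (by positivity)]
    simp
    ring
  · apply Measurable.ennreal_ofReal
    exact ((Complex.continuous_re.comp hcd).div_const _).measurable
  · exact Eventually.of_forall fun θ => ENNReal.ofReal_lt_top

lemma apx_univ {g : ℂ → ℂ} (hg : DifferentiableOn ℂ g (Metric.ball 0 1))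
    (hpos : ∀ w ∈ Metric.ball (0 : ℂ) 1, 0 ≤ (g w).re) {r : ℝ}
    (hr0 : 0 < r) (hr1 : r < 1) : apx g r univ = ENNReal.ofReal (g 0).re := by
  have hcd := apx_dens_cont hg hr0 hr1
  have hcd' := (Complex.continuous_re.comp hcd).div_const (2 * Real.pi)
  have hfin : IsFiniteMeasure (apx g r) := by
    refine isFiniteMeasure_withDensity_ofReal ?_
    exact (hcd'.integrableOn_Ioc).2
  have h := apx_integral hg hpos hr0 hr1 (w := 0) (by simp)
  have h1 : ∀ θ : ℝ, poissonKernel 0 0 (circleMap 0 1 θ) = 1 := by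
    intro θ
    simp [poissonKernel_def]
  simp only [h1, integral_const, smul_eq_mul, mul_one, mul_zero] at h
  rw [← h]
  simp

lemma herglotz {g : ℂ → ℂ} (hg : DifferentiableOn ℂ g (Metric.ball 0 1))
    (hpos : ∀ w ∈ Metric.ball (0 : ℂ) 1, 0 ≤ (g w).re) :
    ∃ ν : Measure ℝ, IsFiniteMeasure ν ∧ ν (Icc 0 (2 * Real.pi))ᶜ = 0 ∧
      ∀ w ∈ Metric.ball (0 : ℂ) 1,
        (g w).re = ∫ θ, poissonKernel 0 w (circleMap 0 1 θ) ∂ν := by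
  let r : ℕ → ℝ := fun n => 1 - 1 / ((n : ℝ) + 2)
  have hr0 : ∀ n, 0 < r n := by
    intro n
    simp only [r]
    rw [sub_pos, div_lt_one (by positivity)]
    have : (0 : ℝ) ≤ n := by positivity
    linarith
  have hr1 : ∀ n, r n < 1 := by
    intro n
    simp only [r]
    have : (0 : ℝ) < 1 / ((n : ℝ) + 2) := by positivity
    linarith
  have hrt : Tendsto r atTop (nhds 1) := by
    have h1 : Tendsto (fun n : ℕ => (n : ℝ) + 2) atTop atTop :=
      tendsto_atTop_add_const_right _ _ tendsto_natCast_atTop_atTop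
    have := (tendsto_const_nhds (x := (1 : ℝ)) (f := atTop)).sub
      ((tendsto_const_nhds (x := (1 : ℝ)) (f := atTop)).div_atTop h1)
    simpa [r] using this
  have hfin : ∀ n, IsFiniteMeasure (apx g (r n)) := fun n =>
    ⟨by rw [apx_univ hg hpos (hr0 n) (hr1 n)]; exact ENNReal.ofReal_lt_top⟩
  let m : ℕ → FiniteMeasure ℝ := fun n => ⟨apx g (r n), hfin n⟩
  have hK : IsCompact (Icc (0 : ℝ) (2 * Real.pi)) := isCompact_Icc
  have hcomp := isCompact_setOfPred_finiteMeasure_le_of_isCompact (g 0).re.toNNReal hK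
  have hmem : ∀ n, m n ∈ {μ : FiniteMeasure ℝ | μ.mass ≤ (g 0).re.toNNReal ∧
      μ (Icc (0 : ℝ) (2 * Real.pi))ᶜ = 0} := by
    intro n
    refine ⟨?_, ?_⟩
    · rw [← ENNReal.coe_le_coe, FiniteMeasure.ennreal_mass]
      exact (apx_univ hg hpos (hr0 n) (hr1 n)).le
    · rw [FiniteMeasure.null_iff_toMeasure_null]
      refine withDensity_absolutelyContinuous _ _ ?_
      rw [Measure.restrict_apply measurableSet_Icc.compl]
      convert measure_empty (μ := (volume : Measure ℝ))
      ext x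
      simp only [mem_inter_iff, mem_compl_iff, mem_Icc, mem_Ioc, mem_empty_iff_false, iff_false]
      rintro ⟨h1, h2, h3⟩
      exact h1 ⟨h2.le, h3⟩
  let U : Ultrafilter ℕ := Filter.hyperfilter ℕ
  obtain ⟨ν, hν, hlim⟩ := hcomp.ultrafilter_le_nhds' (U.map m)
    (by rw [Ultrafilter.mem_map]; exact Filter.univ_mem' hmem)
  have hT : Tendsto m U (nhds ν) := by
    rw [Ultrafilter.coe_map] at hlim
    exact hlim
  have hU : (U : Filter ℕ) ≤ atTop := by
    rw [← Nat.cofinite_eq_atTop]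
    exact Filter.hyperfilter_le_cofinite
  refine ⟨ν, inferInstance, ?_, ?_⟩
  · exact (FiniteMeasure.null_iff_toMeasure_null _ _).1 hν.2
  · intro w hw
    let P : BoundedContinuousFunction ℝ ℝ := BoundedContinuousFunction.ofNormedAddCommGroup
      (fun θ => poissonKernel 0 w (circleMap 0 1 θ)) (continuous_pois_circle hw) _
      (pois_circle_bound hw)
    have h1 := FiniteMeasure.tendsto_iff_forall_integral_tendsto.1 hT P
    have h2 : Tendsto (fun n => (g (r n * w)).re) U (nhds (g w).re) := by
      refine Tendsto.mono_left ?_ hU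
      have hc : ContinuousAt (fun s : ℝ => (g (s * w)).re) 1 := by
        have : ContinuousAt g (((1 : ℝ) : ℂ) * w) := by
          rw [Complex.ofReal_one, one_mul]
          exact (hg.differentiableAt (Metric.isOpen_ball.mem_nhds hw)).continuousAt
        have h3 : ContinuousAt (fun s : ℝ => g (s * w)) 1 :=
          ContinuousAt.comp (f := fun s : ℝ => (s : ℂ) * w) this (by fun_prop)
        exact Complex.continuous_re.continuousAt.comp h3
      have := hc.tendsto.comp hrt
      simpa [Function.comp_def] using this
    refine tendsto_nhds_unique h2 (h1.congr fun n => ?_)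
    exact apx_integral hg hpos (hr0 n) (hr1 n) hw

/-! Stieltjes representation in the half-plane -/

/-- boundary values of the Cayley transform -/
noncomputable def tauc (θ : ℝ) : ℝ := - Real.cos (θ / 2) / Real.sin (θ / 2)

lemma measurable_tauc : Measurable tauc := by
  unfold tauc
  fun_prop

/-- Cayley transform -/
noncomputable def cay (z : ℂ) : ℂ := (z - I) / (z + I)

lemma add_I_ne_zero {z : ℂ} (hz : 0 < z.im) : z + I ≠ 0 := by
  intro h
  have := congrArg Complex.im h
  simp at this
  linarith

lemma cay_mem {z : ℂ} (hz : 0 < z.im) : cay z ∈ Metric.ball (0 : ℂ) 1 := by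
  have h := norm_sub_lt_conj hz (w := I) (by simp)
  simp only [conj_I, sub_neg_eq_add] at h
  simp only [cay, Metric.mem_ball, dist_zero_right, norm_div]
  rw [div_lt_one (norm_pos_iff.2 (add_I_ne_zero hz))]
  exact h

lemma cay_num {z : ℂ} (hz : 0 < z.im) :
    1 - ‖cay z‖ ^ 2 = 4 * z.im / ‖z + I‖ ^ 2 := by
  have h0 : 0 < ‖z + I‖ := norm_pos_iff.2 (add_I_ne_zero hz)
  rw [cay, norm_div, div_pow, eq_div_iff (by positivity), sub_mul,
    div_mul_cancel₀ _ (by positivity), one_mul]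
  rw [← Complex.normSq_eq_norm_sq, ← Complex.normSq_eq_norm_sq, Complex.normSq_apply,
    Complex.normSq_apply]
  simp
  ring

lemma circle_eq {θ : ℝ} (hs : Real.sin (θ / 2) ≠ 0) :
    circleMap 0 1 θ = ((tauc θ : ℂ) - I) / ((tauc θ : ℂ) + I) := by
  have h1 : circleMap 0 1 θ = ((Real.cos (θ/2) : ℂ) + Real.sin (θ/2) * I) ^ 2 := by
    have : circleMap 0 1 θ = Complex.exp (((θ / 2 : ℝ) : ℂ) * I) ^ 2 := by
      rw [← Complex.exp_nat_mul]
      simp only [circleMap, zero_add, Complex.ofReal_one, one_mul]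
      congr 1
      push_cast
      ring
    rw [this, Complex.exp_mul_I, ← Complex.ofReal_cos, ← Complex.ofReal_sin]
  have hcs : (Real.cos (θ/2) : ℂ) ^ 2 + (Real.sin (θ/2) : ℂ) ^ 2 = 1 := by
    exact_mod_cast Real.cos_sq_add_sin_sq (θ/2)
  rw [h1]
  unfold tauc
  have hs' : (Real.sin (θ/2) : ℂ) ≠ 0 := by exact_mod_cast hs
  push_cast
  push_cast at hs' hcs
  set c := Complex.cos (θ/2)
  set s := Complex.sin (θ/2)
  have hne : -c / s + I ≠ 0 := by
    intro h
    have h2 : -c + I * s = 0 := by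
      field_simp at h
      linear_combination h
    have h3 : c ^ 2 + s ^ 2 = 0 := by
      linear_combination (-c - I * s) * h2 + s ^ 2 * I_sq
    rw [hcs] at h3
    exact one_ne_zero h3
  rw [eq_div_iff hne]
  field_simp
  linear_combination (-c - s * I) * hcs + (c * s ^ 2 + s ^ 3 * I) * I_sq

lemma pois_eq {z : ℂ} (hz : 0 < z.im) {θ : ℝ} (hs : Real.sin (θ / 2) ≠ 0) :
    poissonKernel 0 (cay z) (circleMap 0 1 θ)
      = z.im * (1 + tauc θ ^ 2) / ‖z - (tauc θ : ℂ)‖ ^ 2 := by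
  have h0 : 0 < ‖z + I‖ := norm_pos_iff.2 (add_I_ne_zero hz)
  set t := tauc θ with ht
  have hzt : 0 < ‖z - (t : ℂ)‖ := norm_pos_iff.2 (sub_ofReal_ne_zero hz t)
  have htI : (t : ℂ) + I ≠ 0 := by
    intro h
    have := congrArg Complex.im h
    simp at this
  have hnt : ‖(t : ℂ) + I‖ ^ 2 = 1 + t ^ 2 := by
    rw [← Complex.normSq_eq_norm_sq, Complex.normSq_apply]
    simp
    ring
  have hden : circleMap 0 1 θ - cay z = - (2 * I * (z - t)) / ((t + I) * (z + I)) := by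
    rw [circle_eq hs, ← ht, cay]
    have := add_I_ne_zero hz
    field_simp
    ring
  rw [poissonKernel_def]
  simp only [sub_zero, norm_circleMap_zero, abs_one, one_pow]
  rw [cay_num hz, hden, norm_div, norm_neg, norm_mul, norm_mul, norm_mul, div_pow, mul_pow,
    mul_pow, mul_pow, hnt]
  simp only [Complex.norm_ofNat, norm_I]
  have : 0 < 1 + t ^ 2 := by positivity
  field_simp
  ring

lemma pois_eq_sing {z : ℂ} (hz : 0 < z.im) {θ : ℝ} (hs : Real.sin (θ / 2) = 0) :
    poissonKernel 0 (cay z) (circleMap 0 1 θ) = z.im := by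
  have h0 : 0 < ‖z + I‖ := norm_pos_iff.2 (add_I_ne_zero hz)
  have h1 : circleMap 0 1 θ = 1 := by
    have hc : Real.cos θ = 1 := by
      have := Real.cos_sq' (θ / 2)
      have h2 := Real.cos_two_mul (θ / 2)
      rw [hs] at this
      rw [mul_div_cancel₀ _ two_ne_zero, this] at h2
      rw [h2]
      norm_num
    have hsn : Real.sin θ = 0 := by
      have h2 := Real.sin_two_mul (θ / 2)
      rw [mul_div_cancel₀ _ two_ne_zero, hs] at h2
      rw [h2]
      ring
    simp only [circleMap, zero_add, Complex.ofReal_one, one_mul]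
    rw [Complex.exp_mul_I, ← Complex.ofReal_cos, ← Complex.ofReal_sin, hc, hsn]
    simp
  have hden : (1 : ℂ) - cay z = (2 * I) / (z + I) := by
    rw [cay]
    have := add_I_ne_zero hz
    field_simp
    ring
  rw [poissonKernel_def, h1]
  simp only [sub_zero, norm_one, one_pow]
  rw [cay_num hz, hden, norm_div, norm_mul, div_pow, mul_pow]
  simp only [Complex.norm_ofNat, norm_I]
  field_simp
  ring

lemma stieltjes_repr {G : ℂ → ℂ} (hG : DifferentiableOn ℂ G upperHalf)
    (him : ∀ z ∈ upperHalf, (G z).im ≤ 0)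
    (hlim : Tendsto (fun y : ℝ => (y * I : ℂ) * G (y * I)) atTop (nhds 1)) :
    ∃ μ : Measure ℝ, IsProbabilityMeasure μ ∧ ∀ z ∈ upperHalf, G z = cauchyG μ z := by
  let φ : ℂ → ℂ := fun ζ => (I - (starRingEnd ℂ) I * ζ) / (1 - ζ)
  have hφ1 : ∀ ζ ∈ Metric.ball (0 : ℂ) 1, (1 : ℂ) - ζ ≠ 0 := by
    intro ζ hζ h
    have : ζ = 1 := (sub_eq_zero.1 h).symm
    simp [this] at hζ
  have hφm : MapsTo φ (Metric.ball (0 : ℂ) 1) upperHalf := by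
    intro ζ hζ
    exact im_pos_of_disc (by simp) (by simpa using hζ)
  have hφd : DifferentiableOn ℂ φ (Metric.ball (0 : ℂ) 1) := by
    refine DifferentiableOn.div (by fun_prop) (by fun_prop) hφ1
  have hφc : ∀ z ∈ upperHalf, φ (cay z) = z := by
    intro z hz
    have h1 := hφ1 _ (cay_mem hz)
    have h2 := add_I_ne_zero hz
    simp only [φ]
    rw [div_eq_iff h1, cay, conj_I]
    field_simp
    ring
  obtain ⟨ν, hνf, -, hν⟩ := herglotz (g := fun ζ => I * G (φ ζ))
    ((hG.comp hφd hφm).const_mul I)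
    (fun w hw => by
      have := him _ (hφm hw)
      simpa using this)
  have hrep : ∀ z ∈ upperHalf,
      - (G z).im = ∫ θ, poissonKernel 0 (cay z) (circleMap 0 1 θ) ∂ν := by
    intro z hz
    have := hν _ (cay_mem hz)
    rw [hφc z hz] at this
    simpa using this
  have hPint : ∀ z ∈ upperHalf,
      Integrable (fun θ => poissonKernel 0 (cay z) (circleMap 0 1 θ)) ν := by
    intro z hz
    exact Integrable.of_bound (continuous_pois_circle (cay_mem hz)).aestronglyMeasurable _
      (Eventually.of_forall (pois_circle_bound (cay_mem hz)))
  have hPnn : ∀ z ∈ upperHalf, ∀ θ, 0 ≤ poissonKernel 0 (cay z) (circleMap 0 1 θ) := by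
    intro z hz θ
    have hz' : 0 < z.im := hz
    by_cases hs : Real.sin (θ / 2) = 0
    · rw [pois_eq_sing hz hs]
      exact hz'.le
    · rw [pois_eq hz hs]
      positivity
  have hyU : ∀ y : ℝ, 0 < y → (y * I : ℂ) ∈ upperHalf := by
    intro y hy
    simpa [upperHalf] using hy
  have hlim' : Tendsto (fun y : ℝ => y * (- (G (y * I)).im)) atTop (nhds 1) := by
    have := (Complex.continuous_re.tendsto _).comp hlim
    simp only [Complex.one_re] at this
    refine this.congr fun y => ?_
    simp
  -- no mass at the point corresponding to infinity
  set S : Set ℝ := {θ | Real.sin (θ / 2) = 0} with hS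
  have hSm : MeasurableSet S := by
    have : Measurable (fun θ : ℝ => Real.sin (θ / 2)) := by fun_prop
    exact this (measurableSet_singleton 0)
  have hS0 : ν S = 0 := by
    have hb : ∀ y : ℝ, 0 < y → y * (y * ν.real S) ≤ y * (- (G (y * I)).im) := by
      intro y hy
      refine mul_le_mul_of_nonneg_left ?_ hy.le
      rw [hrep _ (hyU y hy)]
      have h1 := setIntegral_le_integral (s := S) (hPint _ (hyU y hy))
        (Eventually.of_forall (hPnn _ (hyU y hy)))
      refine le_trans (le_of_eq ?_) h1
      have h2 : ∫ θ in S, poissonKernel 0 (cay (y * I)) (circleMap 0 1 θ) ∂ν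
          = ∫ θ in S, y ∂ν := by
        refine setIntegral_congr_fun hSm ?_
        intro θ hθ
        have := pois_eq_sing (hyU y hy) (θ := θ) hθ
        simp only [this]
        simp
      rw [h2, setIntegral_const, smul_eq_mul, mul_comm]
    by_contra hne
    have hpos : 0 < ν.real S := by
      rw [measureReal_def]
      exact ENNReal.toReal_pos hne (measure_ne_top _ _)
    have ht : Tendsto (fun y : ℝ => y * (y * ν.real S)) atTop atTop :=
      tendsto_id.atTop_mul_atTop₀ (tendsto_id.atTop_mul_const hpos)
    have e1 := ht.eventually_gt_atTop 2
    have e2 := hlim'.eventually (gt_mem_nhds (show (1 : ℝ) < 2 by norm_num))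
    obtain ⟨y, h1, h2, h3⟩ := (e1.and (e2.and (eventually_gt_atTop 0))).exists
    have := hb y h3
    linarith
  have hae : ∀ᵐ θ ∂ν, Real.sin (θ / 2) ≠ 0 := by
    rw [ae_iff]
    simpa [hS] using hS0
  have hae2 : ∀ z ∈ upperHalf,
      (fun θ => poissonKernel 0 (cay z) (circleMap 0 1 θ)) =ᵐ[ν]
        (fun θ => z.im * (1 + tauc θ ^ 2) / ‖z - (tauc θ : ℂ)‖ ^ 2) := by
    intro z hz
    filter_upwards [hae] with θ hθ
    exact pois_eq hz hθ
  have hmt := measurable_tauc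
  -- total mass
  have hmass : ∫⁻ θ, ENNReal.ofReal (1 + tauc θ ^ 2) ∂ν = 1 := by
    let k : ℕ → ℝ → ℝ := fun n θ =>
      ((n : ℝ) + 1) ^ 2 * (1 + tauc θ ^ 2) / (((n : ℝ) + 1) ^ 2 + tauc θ ^ 2)
    have hk1 : ∀ n, ∫⁻ θ, ENNReal.ofReal (k n θ) ∂ν
        = ENNReal.ofReal (((n : ℝ) + 1) * (- (G ((((n : ℝ) + 1 : ℝ) : ℂ) * I)).im)) := by
      intro n
      have hn : (0 : ℝ) < (n : ℝ) + 1 := by positivity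
      have hU := hyU _ hn
      have he : (fun θ => ((n : ℝ) + 1) *
          poissonKernel 0 (cay ((((n : ℝ) + 1 : ℝ) : ℂ) * I)) (circleMap 0 1 θ)) =ᵐ[ν] k n := by
        filter_upwards [hae2 _ hU] with θ hθ
        rw [hθ]
        have : ‖(((n : ℝ) + 1 : ℝ) : ℂ) * I - (tauc θ : ℂ)‖ ^ 2
            = ((n : ℝ) + 1) ^ 2 + tauc θ ^ 2 := by
          rw [← Complex.normSq_eq_norm_sq, Complex.normSq_apply]
          simp
          ring
        rw [this]
        simp only [k]
        simp
        ring
      rw [hrep _ hU, ← integral_const_mul, integral_congr_ae he,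
        ofReal_integral_eq_lintegral_ofReal (((hPint _ hU).const_mul _).congr he)]
      exact Eventually.of_forall fun θ => by simp only [k, Pi.zero_apply]; positivity
    have t1 : Tendsto (fun n : ℕ => ∫⁻ θ, ENNReal.ofReal (k n θ) ∂ν) atTop (nhds 1) := by
      simp only [hk1]
      have hn1 : Tendsto (fun n : ℕ => (n : ℝ) + 1) atTop atTop :=
        tendsto_atTop_add_const_right _ _ tendsto_natCast_atTop_atTop
      have := ENNReal.tendsto_ofReal (hlim'.comp hn1)
      rw [ENNReal.ofReal_one] at this
      exact this
    have t2 : Tendsto (fun n : ℕ => ∫⁻ θ, ENNReal.ofReal (k n θ) ∂ν) atTop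
        (nhds (∫⁻ θ, ENNReal.ofReal (1 + tauc θ ^ 2) ∂ν)) := by
      refine lintegral_tendsto_of_tendsto_of_monotone ?_ ?_ ?_
      · intro n
        apply Measurable.aemeasurable
        simp only [k]
        fun_prop
      · refine Eventually.of_forall fun θ => ?_
        intro n m hnm
        refine ENNReal.ofReal_le_ofReal ?_
        simp only [k]
        have hnm' : (n : ℝ) ≤ m := by exact_mod_cast hnm
        have hn0 : (0 : ℝ) ≤ n := by positivity
        have hsq : ((n : ℝ) + 1) ^ 2 ≤ ((m : ℝ) + 1) ^ 2 := by nlinarith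
        rw [div_le_div_iff₀ (by positivity) (by positivity)]
        set A := ((n : ℝ) + 1) ^ 2
        set B := ((m : ℝ) + 1) ^ 2
        have hT : 0 ≤ tauc θ ^ 2 := by positivity
        have : 0 ≤ (1 + tauc θ ^ 2) * tauc θ ^ 2 * (B - A) :=
          mul_nonneg (by positivity) (by linarith)
        nlinarith
      · refine Eventually.of_forall fun θ => ?_
        refine ENNReal.tendsto_ofReal ?_
        have hn1 : Tendsto (fun n : ℕ => ((n : ℝ) + 1) ^ 2) atTop atTop :=
          (tendsto_pow_atTop two_ne_zero).comp
            (tendsto_atTop_add_const_right _ _ tendsto_natCast_atTop_atTop)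
        have hT : Tendsto (fun n : ℕ => (1 + tauc θ ^ 2)
            - (1 + tauc θ ^ 2) * tauc θ ^ 2 / (((n : ℝ) + 1) ^ 2 + tauc θ ^ 2)) atTop
            (nhds (1 + tauc θ ^ 2)) := by
          have := (tendsto_const_nhds (x := 1 + tauc θ ^ 2) (f := atTop)).sub
            ((tendsto_const_nhds (x := (1 + tauc θ ^ 2) * tauc θ ^ 2) (f := atTop)).div_atTop
              (tendsto_atTop_add_const_right _ (tauc θ ^ 2) hn1))
          rwa [sub_zero] at this
        refine hT.congr fun n => ?_
        simp only [k]
        field_simp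
        ring
    exact tendsto_nhds_unique t2 t1
  -- the measure
  set ρ : Measure ℝ := ν.withDensity (fun θ => ENNReal.ofReal (1 + tauc θ ^ 2)) with hρ
  have hρ1 : IsProbabilityMeasure ρ := by
    refine ⟨?_⟩
    rw [hρ, withDensity_apply _ MeasurableSet.univ, Measure.restrict_univ]
    exact hmass
  have hμ : IsProbabilityMeasure (ρ.map tauc) := Measure.isProbabilityMeasure_map hmt.aemeasurable
  refine ⟨ρ.map tauc, hμ, ?_⟩
  have himeq : ∀ z ∈ upperHalf, (cauchyG (ρ.map tauc) z).im = (G z).im := by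
    intro z hz
    rw [cauchyG_im _ hz, integral_map hmt.aemeasurable (integrable_pois _ hz).aestronglyMeasurable,
      hρ, integral_withDensity_eq_integral_toReal_smul (by fun_prop)
        (Eventually.of_forall fun θ => ENNReal.ofReal_lt_top)]
    rw [neg_eq_iff_eq_neg, hrep z hz, integral_congr_ae (hae2 z hz)]
    congr 1
    ext θ
    rw [ENNReal.toReal_ofReal (by positivity), smul_eq_mul]
    ring
  have hDd : DifferentiableOn ℂ (fun z => G z - cauchyG (ρ.map tauc) z) upperHalf :=
    hG.sub (cauchyG_differentiableOn _)
  have hconv : Convex ℝ upperHalf := convex_halfSpace_im_gt 0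
  obtain ⟨c, hc⟩ := AnalyticOnNhd.eq_const_of_im_eq_const (c₀ := 0)
    (hDd.analyticOnNhd isOpen_upperHalf)
    (fun z hz => by simp [himeq z hz]) isOpen_upperHalf ⟨⟨I, by simp [upperHalf]⟩, hconv.isPreconnected⟩
  have hc0 : c = 0 := by
    have h1 := hlim.sub (cauchyG_iy_tendsto (ρ.map tauc))
    rw [sub_self] at h1
    have h2 : Tendsto (fun y : ℝ => (y * I : ℂ) * c) atTop (nhds 0) := by
      refine h1.congr' ?_
      filter_upwards [eventually_gt_atTop 0] with y hy
      rw [← mul_sub]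
      congr 1
      exact hc _ (hyU y hy)
    have h3 : Tendsto (fun y : ℝ => y⁻¹) atTop (nhds 0) := tendsto_inv_atTop_zero
    have h4 := h2.norm.mul h3
    simp only [norm_zero, zero_mul] at h4
    have h5 : Tendsto (fun y : ℝ => ‖c‖) atTop (nhds 0) := by
      refine h4.congr' ?_
      filter_upwards [eventually_gt_atTop 0] with y hy
      simp [abs_of_pos hy]
      field_simp
    have := tendsto_nhds_unique h5 tendsto_const_nhds
    exact norm_eq_zero.1 this.symm
  intro z hz
  have := hc z hz
  rw [hc0] at this
  exact sub_eq_zero.1 this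

lemma classF_of {Z : ℂ → ℂ} (hd : DifferentiableOn ℂ Z upperHalf)
    (him : ∀ z ∈ upperHalf, z.im ≤ (Z z).im)
    (has : ∀ δ > (0 : ℝ), ∃ Y > (0 : ℝ), ∀ y ≥ Y, ‖Z (y * I) - y * I‖ ≤ δ * y) : classF Z := by
  have hpos : ∀ z ∈ upperHalf, 0 < (Z z).im := fun z hz => lt_of_lt_of_le hz (him z hz)
  have hne : ∀ z ∈ upperHalf, Z z ≠ 0 := by
    intro z hz h
    have := hpos z hz
    simp [h] at this
  have hq : Tendsto (fun y : ℝ => Z (y * I) / (y * I)) atTop (nhds 1) := by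
    rw [Metric.tendsto_nhds]
    intro ε hε
    obtain ⟨Y, hY, H⟩ := has (ε / 2) (by positivity)
    filter_upwards [eventually_ge_atTop Y] with y hy
    have hy0 : 0 < y := lt_of_lt_of_le hY hy
    have hyI : (y * I : ℂ) ≠ 0 := by
      simp [hy0.ne']
    rw [dist_eq_norm]
    have : Z (y * I) / (y * I) - 1 = (Z (y * I) - y * I) / (y * I) := by
      rw [sub_div, div_self hyI]
    rw [this, norm_div, div_lt_iff₀ (norm_pos_iff.2 hyI)]
    have h1 := H y hy
    simp only [norm_mul, norm_I, mul_one, Complex.norm_real, Real.norm_eq_abs, abs_of_pos hy0]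
    nlinarith
  obtain ⟨μ, hμ, h⟩ := stieltjes_repr (G := fun z => (Z z)⁻¹) (hd.inv hne)
    (fun z hz => by
      rw [Complex.inv_im]
      exact div_nonpos_of_nonpos_of_nonneg (by linarith [hpos z hz]) (Complex.normSq_nonneg _))
    (by
      have := hq.inv₀ one_ne_zero
      rw [inv_one] at this
      refine this.congr fun y => ?_
      rw [inv_div, div_eq_mul_inv])
  refine ⟨μ, hμ, fun z hz => ?_⟩
  rw [recF, ← h z hz, inv_inv]

/-- Theorem 2.1: existence and uniqueness of subordination functions for
additive free convolution. -/
theorem additive_subordination (μ₁ μ₂ : Measure ℝ)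
    (h₁ : IsProbabilityMeasure μ₁) (h₂ : IsProbabilityMeasure μ₂) :
    ∃ Z₁ Z₂ : ℂ → ℂ, classF Z₁ ∧ classF Z₂ ∧
      (∀ z ∈ upperHalf,
        z = Z₁ z + Z₂ z - recF μ₁ (Z₁ z) ∧ recF μ₁ (Z₁ z) = recF μ₂ (Z₂ z)) ∧
      (∀ W₁ W₂ : ℂ → ℂ, classF W₁ → classF W₂ →
        (∀ z ∈ upperHalf,
          z = W₁ z + W₂ z - recF μ₁ (W₁ z) ∧ recF μ₁ (W₁ z) = recF μ₂ (W₂ z)) →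
        ∀ z ∈ upperHalf, W₁ z = Z₁ z ∧ W₂ z = Z₂ z) := by
  set k₁ : ℂ → ℂ := fun w => recF μ₁ w - w with hk₁
  set k₂ : ℂ → ℂ := fun w => recF μ₂ w - w with hk₂
  have hd₁ : DifferentiableOn ℂ k₁ upperHalf := (recF_differentiableOn μ₁).sub differentiableOn_id
  have hd₂ : DifferentiableOn ℂ k₂ upperHalf := (recF_differentiableOn μ₂).sub differentiableOn_id
  have hi₁ : ∀ z ∈ upperHalf, 0 ≤ (k₁ z).im := fun z hz => by
    simpa [k₁] using recF_im_ge μ₁ hz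
  have hi₂ : ∀ z ∈ upperHalf, 0 ≤ (k₂ z).im := fun z hz => by
    simpa [k₂] using recF_im_ge μ₂ hz
  have hs₁ : SmallAtInf k₁ := fun δ hδ => recF_asymp μ₁ hδ
  have hs₂ : SmallAtInf k₂ := fun δ hδ => recF_asymp μ₂ hδ
  obtain ⟨Z, hZd, hZim, hZ, hZa⟩ := exists_fixed k₁ k₂ hd₁ hd₂ hi₁ hi₂ hs₁ hs₂
  have hZU : ∀ z ∈ upperHalf, Z z ∈ upperHalf := fun z hz => lt_of_lt_of_le hz (hZim z hz)
  refine ⟨Z, fun z => z + k₁ (Z z), classF_of hZd hZim hZa, classF_of ?_ ?_ ?_, ?_, ?_⟩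
  · exact differentiableOn_id.add (hd₁.comp hZd hZU)
  · intro z hz
    have := hi₁ _ (hZU z hz)
    simp only [add_im]
    linarith
  · intro δ hδ
    obtain ⟨Y₁, hY₁, H₁⟩ := hs₁ δ hδ
    obtain ⟨Y₂, hY₂, H₂⟩ := hZa (1 / 2) (by norm_num)
    refine ⟨max Y₁ Y₂, by positivity, fun y hy => ?_⟩
    rw [add_sub_cancel_left]
    refine H₁ y ((le_max_left _ _).trans hy) _ ?_
    have := H₂ y ((le_max_right _ _).trans hy)
    linarith
  · intro z hz
    have h := hZ z hz
    simp only [hk₁, hk₂] at h ⊢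
    constructor
    · ring
    · linear_combination h
  · intro W₁ W₂ hW₁ hW₂ hW z hz
    obtain ⟨e1, e2⟩ := hW z hz
    have hz' : 0 < z.im := hz
    have hW₁U : 0 < (W₁ z).im := by
      obtain ⟨μ, hμ, h⟩ := hW₁
      rw [h z hz]
      exact hz'.trans_le (recF_im_ge μ hz)
    have hW2 : W₂ z = z + k₁ (W₁ z) := by
      simp only [hk₁]
      linear_combination -e1
    have hW1 : z + k₂ (z + k₁ (W₁ z)) = W₁ z := by
      rw [← hW2]
      simp only [hk₂]
      linear_combination e1 - e2
    have hmid : ∀ w ∈ upperHalf, z + k₁ w ∈ upperHalf := by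
      intro w hw
      have := hi₁ w hw
      simp only [upperHalf, mem_ofPred_eq, add_im]
      linarith
    have hfd : DifferentiableOn ℂ (fun w => z + k₂ (z + k₁ w)) upperHalf :=
      (hd₂.comp (hd₁.const_add z) hmid).const_add z
    have heq : W₁ z = Z z := by
      refine fixed_unique hz' hfd ?_ hW₁U (hZU z hz) hW1 (hZ z hz).symm
      intro w hw
      have := hi₂ _ (hmid w hw)
      simp only [add_im] at this ⊢
      linarith
    exact ⟨heq, by rw [hW2, heq]⟩
end

section
/- Let n ≥ 2 and let μ₁, …, μₙ be Borel probability measures on ℝ. Then there exist unique functions Z₁, …, Zₙ in the class 𝓕 such that for all z ∈ ℂ⁺ one has z = Z₁(z) + ⋯ + Zₙ(z) − (n − 1)·F_{μ₁}(Z₁(z)) and F_{μ₁}(Z₁(z)) = F_{μ₂}(Z₂(z)) = ⋯ = F_{μₙ}(Zₙ(z)). -/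
open MeasureTheory Complex Filter Set

open Topology

namespace AddSub

lemma sub_ne {z : ℂ} (hz : z ∈ upperHalf) (t : ℝ) : z - (t : ℂ) ≠ 0 := by
  intro h
  have := congrArg Complex.im h
  simp at this
  exact (ne_of_gt hz) this

lemma im_le_norm_sub {z : ℂ} (t : ℝ) : z.im ≤ ‖z - (t : ℂ)‖ := by
  have := Complex.im_le_norm (z - (t : ℂ))
  simpa using this

lemma norm_inv_le {z : ℂ} (hz : z ∈ upperHalf) (t : ℝ) : ‖(z - (t : ℂ))⁻¹‖ ≤ z.im⁻¹ := by
  rw [norm_inv]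
  exact inv_anti₀ hz (im_le_norm_sub t)

lemma integrable_inv {μ : Measure ℝ} [IsFiniteMeasure μ] {z : ℂ} (hz : z ∈ upperHalf) :
    Integrable (fun t : ℝ => (z - (t : ℂ))⁻¹) μ := by
  refine Integrable.of_bound (C := z.im⁻¹) ?_ (Eventually.of_forall (norm_inv_le hz))
  exact (by fun_prop : Measurable (fun t : ℝ => (z - (t : ℂ))⁻¹)).aestronglyMeasurable

lemma isOpen_upperHalf : IsOpen upperHalf := isOpen_lt continuous_const Complex.continuous_im

lemma convex_upperHalf : Convex ℝ upperHalf := convex_halfSpace_im_gt 0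

lemma differentiableOn_cauchyG (μ : Measure ℝ) [IsFiniteMeasure μ] :
    DifferentiableOn ℂ (cauchyG μ) upperHalf := by
  have h := (analyticOn_resolventTransform (μ := μ)).differentiableOn
  have h2 : cauchyG μ = fun z => - resolventTransform μ z := by
    ext z
    rw [resolventTransform_apply, ← integral_neg, cauchyG]
    congr 1
    ext t
    rw [resolvent, Ring.inverse_eq_inv', ← inv_neg]
    simp
  rw [h2]
  refine DifferentiableOn.neg (h.mono ?_)
  rintro z hz ⟨t, -, rfl⟩
  simp [upperHalf] at hz

lemma im_inv_sub {z : ℂ} (t : ℝ) : ((z - (t : ℂ))⁻¹).im = - (z.im * ‖(z - (t:ℂ))⁻¹‖ ^ 2) := by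
  rw [Complex.inv_im, norm_inv, inv_pow, Complex.normSq_eq_norm_sq]
  simp [div_eq_mul_inv]

lemma im_cauchyG {μ : Measure ℝ} [IsFiniteMeasure μ] {z : ℂ} (hz : z ∈ upperHalf) :
    (cauchyG μ z).im = - ∫ t : ℝ, z.im * ‖(z - (t:ℂ))⁻¹‖ ^ 2 ∂μ := by
  have h : (cauchyG μ z).im = ∫ t : ℝ, ((z - (t : ℂ))⁻¹).im ∂μ :=
    ((Complex.imCLM.integral_comp_comm (integrable_inv (μ := μ) hz))).symm
  rw [h, ← integral_neg]
  simp_rw [im_inv_sub]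

lemma norm_sq_le {μ : Measure ℝ} [IsProbabilityMeasure μ] {z : ℂ} (hz : z ∈ upperHalf) :
    z.im * ‖cauchyG μ z‖ ^ 2 ≤ - (cauchyG μ z).im := by
  rw [im_cauchyG hz, neg_neg, integral_const_mul]
  refine mul_le_mul_of_nonneg_left ?_ (le_of_lt hz)
  have hi : Integrable (fun t : ℝ => ‖(z - (t : ℂ))⁻¹‖) μ := (integrable_inv hz).norm
  have hi2 : Integrable (fun t : ℝ => ‖(z - (t : ℂ))⁻¹‖ ^ 2) μ := by
    refine Integrable.of_bound (C := (z.im⁻¹)^2) ?_ (Eventually.of_forall fun t => ?_)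
    · exact (by fun_prop : Measurable (fun t : ℝ => ‖(z - (t : ℂ))⁻¹‖ ^ 2)).aestronglyMeasurable
    · rw [Real.norm_of_nonneg (by positivity)]
      exact pow_le_pow_left₀ (norm_nonneg _) (norm_inv_le hz t) 2
  set m := ∫ t : ℝ, ‖(z - (t : ℂ))⁻¹‖ ∂μ with hm
  have h1 : ‖cauchyG μ z‖ ≤ m := norm_integral_le_integral_norm _
  have h2 : 0 ≤ ∫ t : ℝ, (‖(z - (t : ℂ))⁻¹‖ - m) ^ 2 ∂μ :=
    integral_nonneg fun t => sq_nonneg _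
  have h3 : ∫ t : ℝ, (‖(z - (t : ℂ))⁻¹‖ - m) ^ 2 ∂μ
      = ∫ t : ℝ, ‖(z - (t : ℂ))⁻¹‖ ^ 2 ∂μ - m ^ 2 := by
    have : ∀ t : ℝ, (‖(z - (t : ℂ))⁻¹‖ - m) ^ 2 =
      ‖(z - (t : ℂ))⁻¹‖ ^ 2 - (2 * m) * ‖(z - (t : ℂ))⁻¹‖ + m ^ 2 := fun t => by ring
    simp_rw [this]
    have hs : Integrable (fun t : ℝ => ‖(z - (t : ℂ))⁻¹‖ ^ 2 - (2 * m) * ‖(z - (t : ℂ))⁻¹‖) μ :=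
      hi2.sub (hi.const_mul _)
    rw [integral_add hs (integrable_const _),
      integral_sub hi2 (hi.const_mul _), integral_const_mul, ← hm]
    simp
    ring
  have : ‖cauchyG μ z‖ ^ 2 ≤ m ^ 2 := pow_le_pow_left₀ (norm_nonneg _) h1 2
  linarith

lemma im_cauchyG_neg {μ : Measure ℝ} [IsProbabilityMeasure μ] {z : ℂ} (hz : z ∈ upperHalf) :
    (cauchyG μ z).im < 0 := by
  rw [im_cauchyG hz, neg_lt_zero]
  have hz' : 0 < z.im := hz
  rw [integral_pos_iff_support_of_nonneg]
  · have : Function.support (fun t : ℝ => z.im * ‖(z - (t:ℂ))⁻¹‖ ^ 2) = univ := by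
      ext t
      simp [sub_ne hz t, hz'.ne']
    rw [this]; simp
  · intro t; positivity
  · refine Integrable.of_bound (C := z.im * (z.im⁻¹)^2) ?_ (Eventually.of_forall fun t => ?_)
    · exact (by fun_prop :
        Measurable (fun t : ℝ => z.im * ‖(z - (t : ℂ))⁻¹‖ ^ 2)).aestronglyMeasurable
    · rw [Real.norm_of_nonneg (by positivity)]
      gcongr
      exact norm_inv_le hz t

lemma cauchyG_ne {μ : Measure ℝ} [IsProbabilityMeasure μ] {z : ℂ} (hz : z ∈ upperHalf) :
    cauchyG μ z ≠ 0 := fun h => by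
  have := im_cauchyG_neg (μ := μ) hz
  simp [h] at this

lemma differentiableOn_recF (μ : Measure ℝ) [IsProbabilityMeasure μ] :
    DifferentiableOn ℂ (recF μ) upperHalf :=
  (differentiableOn_cauchyG μ).inv fun _ hz => cauchyG_ne hz

lemma im_recF {μ : Measure ℝ} [IsProbabilityMeasure μ] {z : ℂ} (hz : z ∈ upperHalf) :
    z.im ≤ (recF μ z).im := by
  have h := norm_sq_le (μ := μ) hz
  have h0 : 0 < ‖cauchyG μ z‖ ^ 2 := by
    have := norm_pos_iff.2 (cauchyG_ne (μ := μ) hz)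
    positivity
  rw [recF, Complex.inv_im, Complex.normSq_eq_norm_sq, le_div_iff₀ h0]
  exact h

/-- Nontangential filter at infinity. -/
def ntInf : Filter ℂ := comap Complex.im atTop ⊓ 𝓟 {z | ‖z‖ ≤ 3 * z.im}

instance : ntInf.IsCountablyGenerated := by unfold ntInf; infer_instance

lemma ntInf_im (Y : ℝ) : ∀ᶠ z in ntInf, Y < z.im :=
  (tendsto_comap.eventually (eventually_gt_atTop Y)).filter_mono inf_le_left

lemma ntInf_cone : ∀ᶠ z in ntInf, ‖z‖ ≤ 3 * z.im :=
  (eventually_principal.2 fun _ h => h).filter_mono inf_le_right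

lemma tendsto_mul_cauchyG (μ : Measure ℝ) [IsFiniteMeasure μ] :
    Tendsto (fun z => z * cauchyG μ z) ntInf (𝓝 (μ.real univ : ℂ)) := by
  have h1 : ((μ.real univ : ℝ) : ℂ) = ∫ _t : ℝ, (1 : ℂ) ∂μ := by simp
  rw [h1]
  simp_rw [cauchyG, ← integral_const_mul]
  refine tendsto_integral_filter_of_dominated_convergence (fun _ => 3) ?_ ?_ (integrable_const _) ?_
  · exact Eventually.of_forall fun z =>
      (by fun_prop : Measurable (fun t : ℝ => z * (z - (t : ℂ))⁻¹)).aestronglyMeasurable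
  · filter_upwards [ntInf_im 0, ntInf_cone] with z hz hc
    refine Eventually.of_forall fun t => ?_
    rw [norm_mul]
    calc ‖z‖ * ‖(z - (t:ℂ))⁻¹‖ ≤ (3 * z.im) * z.im⁻¹ := by
          gcongr
          exact norm_inv_le hz t
      _ = 3 := by field_simp
  · refine Eventually.of_forall fun t => ?_
    have h2 : Tendsto (fun z : ℂ => 1 + t * (z - (t : ℂ))⁻¹) ntInf (𝓝 (1 + t * 0)) := by
      refine tendsto_const_nhds.add (tendsto_const_nhds.mul ?_)
      rw [tendsto_zero_iff_norm_tendsto_zero]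
      refine squeeze_zero' (Eventually.of_forall fun _ => norm_nonneg _)
        (g := fun z => z.im⁻¹) ?_ ?_
      · filter_upwards [ntInf_im 0] with z hz using norm_inv_le hz t
      · exact tendsto_inv_atTop_zero.comp (tendsto_comap.mono_left inf_le_left)
    rw [mul_zero, add_zero] at h2
    refine h2.congr' ?_
    filter_upwards [ntInf_im 0] with z hz
    have := sub_ne hz t
    field_simp
    ring

lemma tendsto_I : Tendsto (fun y : ℝ => (y : ℂ) * I) atTop ntInf := by
  refine tendsto_inf.2 ⟨tendsto_comap_iff.2 ?_, tendsto_principal.2 ?_⟩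
  · refine tendsto_id.congr fun y => by simp
  · filter_upwards [eventually_ge_atTop 0] with y hy
    simp [abs_of_nonneg hy]
    linarith

/-- The sublinear part of the reciprocal Cauchy transform. -/
noncomputable def hh (μ : Measure ℝ) (z : ℂ) : ℂ := recF μ z - z

lemma hh_im {μ : Measure ℝ} [IsProbabilityMeasure μ] {z : ℂ} (hz : z ∈ upperHalf) :
    0 ≤ (hh μ z).im := by
  have := im_recF (μ := μ) hz
  simp [hh]; exact this

lemma hh_diff (μ : Measure ℝ) [IsProbabilityMeasure μ] : DifferentiableOn ℂ (hh μ) upperHalf :=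
  (differentiableOn_recF μ).sub differentiableOn_id

lemma hh_small (μ : Measure ℝ) [IsProbabilityMeasure μ] {ε : ℝ} (hε : 0 < ε) :
    ∀ᶠ z in ntInf, ‖hh μ z‖ ≤ ε * z.im := by
  have h := tendsto_mul_cauchyG μ
  simp only [probReal_univ, ofReal_one] at h
  have h2 := (h.inv₀ one_ne_zero).sub_const 1
  simp only [inv_one, sub_self] at h2
  have h3 := h2.norm.eventually_lt_const (u := ε / 3) (by rw [norm_zero]; positivity)
  filter_upwards [h3, ntInf_im 0, ntInf_cone] with z h3 h0 hc
  have hz : z ≠ 0 := by rintro rfl; simp at h0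
  have : hh μ z = z * ((z * cauchyG μ z)⁻¹ - 1) := by
    have := cauchyG_ne (μ := μ) h0
    rw [hh, recF]; field_simp
  rw [this, norm_mul]
  calc _ ≤ (3 * z.im) * (ε / 3) := by gcongr
    _ = _ := by ring
lemma vitali_disc (g : ℕ → ℂ → ℂ) (hd : ∀ k, DifferentiableOn ℂ (g k) (Metric.ball 0 1))
    (hb : ∀ k, ∀ w ∈ Metric.ball (0 : ℂ) 1, ‖g k w‖ ≤ 1) {ρ : ℝ} (hρ : 0 < ρ) (hρ1 : ρ < 1)
    (hu : UniformCauchySeqOn g atTop (Metric.closedBall 0 ρ)) :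
    ∃ f : ℂ → ℂ, DifferentiableOn ℂ f (Metric.ball 0 1) ∧
      ∀ w ∈ Metric.ball (0 : ℂ) 1, Tendsto (fun k => g k w) atTop (𝓝 (f w)) := by
  set a : ℕ → ℕ → ℂ := fun k n => ((n.factorial : ℂ))⁻¹ * iteratedDeriv n (g k) 0 with ha
  have hdc : ∀ r < (1:ℝ), ∀ k, DiffContOnCl ℂ (g k) (Metric.ball 0 r) := fun r hr k =>
    (hd k).diffContOnCl_ball (Metric.closedBall_subset_ball hr)
  have hab : ∀ r : ℝ, 0 < r → r < 1 → ∀ k n, ‖a k n‖ ≤ (r⁻¹) ^ n := by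
    intro r hr hr1 k n
    have := Complex.norm_iteratedDeriv_le_of_forall_mem_sphere_norm_le (n := n) (C := 1) hr
      (hdc r hr1 k)
      (fun z hz => hb k z (Metric.closedBall_subset_ball hr1 (Metric.sphere_subset_closedBall hz)))
    have hn : (0:ℝ) < n.factorial := by exact_mod_cast n.factorial_pos
    rw [ha]
    simp only [norm_mul, norm_inv, Complex.norm_natCast]
    calc _ ≤ ((n.factorial : ℝ))⁻¹ * (n.factorial * 1 / r ^ n) := by gcongr
      _ = _ := by rw [inv_pow]; field_simp
  have hac : ∀ n, ∃ A, Tendsto (fun k => a k n) atTop (𝓝 A) := by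
    intro n
    apply cauchySeq_tendsto_of_complete
    rw [Metric.cauchySeq_iff']
    intro ε hε
    rw [Metric.uniformCauchySeqOn_iff] at hu
    obtain ⟨N, hN⟩ := hu (ε / 2 * ρ ^ n) (by positivity)
    refine ⟨N, fun k hk => ?_⟩
    have hc := Complex.norm_iteratedDeriv_le_of_forall_mem_sphere_norm_le (n := n)
      (C := ε / 2 * ρ ^ n) hρ ((hdc ρ hρ1 k).sub (hdc ρ hρ1 N))
      (fun z hz => by
        have := hN k hk N le_rfl z (Metric.sphere_subset_closedBall hz)
        rw [dist_eq_norm] at this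
        exact this.le)
    have hcd : ∀ k, ContDiffAt ℂ n (g k) 0 := fun k =>
      ((hd k).analyticAt (Metric.ball_mem_nhds 0 one_pos)).contDiffAt
    rw [iteratedDeriv_sub (hcd k) (hcd N)] at hc
    have hn : (0:ℝ) < n.factorial := by exact_mod_cast n.factorial_pos
    rw [dist_eq_norm, ha]
    simp only [← mul_sub, norm_mul, norm_inv, Complex.norm_natCast]
    calc _ ≤ ((n.factorial : ℝ))⁻¹ * (n.factorial * (ε / 2 * ρ ^ n) / ρ ^ n) := by gcongr
      _ = ε / 2 := by field_simp
      _ < ε := by linarith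
  choose A hA using hac
  have hAb : ∀ r : ℝ, 0 < r → r < 1 → ∀ n, ‖A n‖ ≤ (r⁻¹) ^ n := fun r hr hr1 n =>
    le_of_tendsto (hA n).norm (Eventually.of_forall fun k => hab r hr hr1 k n)
  have hsum : ∀ s r : ℝ, 0 ≤ s → s < r → Summable fun n : ℕ => (r⁻¹) ^ n * s ^ n := by
    intro s r hs hsr
    have hr : 0 < r := by linarith
    simp_rw [← mul_pow]
    refine summable_geometric_of_lt_one (by positivity) ?_
    rw [inv_mul_lt_iff₀ hr]; linarith
  refine ⟨fun w => ∑' n, A n * w ^ n, ?_, ?_⟩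
  · intro w hw
    rw [mem_ball_zero_iff] at hw
    obtain ⟨s, hs1, hs2⟩ := exists_between hw
    obtain ⟨r, hr1, hr2⟩ := exists_between hs2
    have hs0 : 0 < s := lt_of_le_of_lt (norm_nonneg _) hs1
    have : DifferentiableOn ℂ (fun w => ∑' n, A n * w ^ n) (Metric.ball 0 s) := by
      refine differentiableOn_tsum_of_summable_norm (hsum s r hs0.le hr1) (fun n => by fun_prop)
        Metric.isOpen_ball ?_
      intro n w hw
      rw [mem_ball_zero_iff] at hw
      rw [norm_mul, norm_pow]
      exact mul_le_mul (hAb r (by linarith) hr2 n) (pow_le_pow_left₀ (norm_nonneg _) hw.le n)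
        (by positivity) (pow_nonneg (inv_nonneg.2 (by linarith)) n)
    exact (this.differentiableAt (Metric.isOpen_ball.mem_nhds (by simpa using hs1))).differentiableWithinAt
  · intro w hw
    have hw' := hw
    rw [mem_ball_zero_iff] at hw'
    obtain ⟨r, hr1, hr2⟩ := exists_between hw'
    have hr0 : 0 < r := lt_of_le_of_lt (norm_nonneg _) hr1
    have h1 : ∀ k, g k w = ∑' n, a k n * w ^ n := by
      intro k
      have := Complex.taylorSeries_eq_on_ball' hw (hd k)
      rw [← this]
      simp [ha]
    simp_rw [h1]
    refine tendsto_tsum_of_dominated_convergence (hsum ‖w‖ r (norm_nonneg _) hr1) ?_ ?_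
    · intro n
      exact (hA n).mul_const _
    · refine Eventually.of_forall fun k n => ?_
      rw [norm_mul, norm_pow]
      gcongr
      exact hab r hr0 hr2 k n
/-- Cayley transform. -/
noncomputable def cay (Y : ℝ) (z : ℂ) : ℂ := (z - Y * I) / (z + Y * I)

/-- Inverse Cayley transform. -/
noncomputable def yac (Y : ℝ) (w : ℂ) : ℂ := Y * I * (1 + w) / (1 - w)

lemma cay_den {Y : ℝ} (_hY : 0 < Y) {z : ℂ} (hz : z ∈ upperHalf) : Y < ‖z + Y * I‖ := by
  refine lt_of_lt_of_le ?_ (Complex.im_le_norm _)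
  have : 0 < z.im := hz
  simp; exact this

lemma cay_den_ne {Y : ℝ} (hY : 0 < Y) {z : ℂ} (hz : z ∈ upperHalf) : z + Y * I ≠ 0 :=
  norm_pos_iff.1 (hY.trans (cay_den hY hz))

lemma norm_cay {Y : ℝ} (hY : 0 < Y) {z : ℂ} (hz : z ∈ upperHalf) : ‖cay Y z‖ < 1 := by
  rw [cay, norm_div, div_lt_one (hY.trans (cay_den hY hz))]
  refine lt_of_pow_lt_pow_left₀ 2 (norm_nonneg _) ?_
  have hz' : 0 < z.im := hz
  rw [← Complex.normSq_eq_norm_sq, ← Complex.normSq_eq_norm_sq, Complex.normSq_apply,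
    Complex.normSq_apply]
  simp
  nlinarith [mul_pos hY hz']

lemma one_sub_ne {w : ℂ} (hw : ‖w‖ < 1) : 1 - w ≠ 0 := by
  intro h
  have : w = 1 := by linear_combination -h
  simp [this] at hw

lemma yac_im {Y : ℝ} (hY : 0 < Y) {w : ℂ} (hw : ‖w‖ < 1) : yac Y w ∈ upperHalf := by
  have h1 : (yac Y w).im = Y * (1 - ‖w‖ ^ 2) / ‖1 - w‖ ^ 2 := by
    rw [yac, Complex.div_im, ← Complex.normSq_eq_norm_sq, ← Complex.normSq_eq_norm_sq,
      Complex.normSq_apply, Complex.normSq_apply]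
    simp
    ring
  have h2 : 0 < ‖1 - w‖ := norm_pos_iff.2 (one_sub_ne hw)
  change 0 < (yac Y w).im
  rw [h1]
  have : ‖w‖ ^ 2 < 1 := by nlinarith [norm_nonneg w]
  have : 0 < 1 - ‖w‖ ^ 2 := by linarith
  positivity

lemma yac_cay {Y : ℝ} (hY : 0 < Y) {z : ℂ} (hz : z ∈ upperHalf) : yac Y (cay Y z) = z := by
  have h := cay_den_ne hY hz
  have hY' : (Y : ℂ) ≠ 0 := by exact_mod_cast hY.ne'
  have h2 : 1 - cay Y z ≠ 0 := one_sub_ne (norm_cay hY hz)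
  rw [yac, div_eq_iff h2, cay]
  field_simp
  ring

lemma cay_diff {Y : ℝ} (hY : 0 < Y) : DifferentiableOn ℂ (cay Y) upperHalf := by
  unfold cay
  exact DifferentiableOn.div (by fun_prop) (by fun_prop) fun z hz => cay_den_ne hY hz

lemma yac_diff {Y : ℝ} : DifferentiableOn ℂ (yac Y) (Metric.ball 0 1) := by
  unfold yac
  exact DifferentiableOn.div (by fun_prop) (by fun_prop)
    fun z hz => one_sub_ne (by simpa using hz)

lemma cay_sub {Y : ℝ} (hY : 0 < Y) {z w : ℂ} (hz : z ∈ upperHalf) (hw : w ∈ upperHalf) :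
    ‖cay Y z - cay Y w‖ ≤ 2 / Y * ‖z - w‖ := by
  have h1 := cay_den hY hz
  have h2 := cay_den hY hw
  have : cay Y z - cay Y w = 2 * Y * I * (z - w) / ((z + Y * I) * (w + Y * I)) := by
    have h1 := cay_den_ne hY hz
    have h2 := cay_den_ne hY hw
    rw [cay, cay]; field_simp; ring
  rw [this, norm_div, norm_mul (2 * (Y : ℂ) * I), norm_mul (z + Y * I)]
  have h3 : ‖2 * (Y : ℂ) * I‖ = 2 * Y := by simp [abs_of_pos hY]
  rw [h3]
  calc _ ≤ 2 * Y * ‖z - w‖ / (Y * Y) := by gcongr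
    _ = _ := by field_simp

lemma vitali_half (f : ℕ → ℂ → ℂ) (hd : ∀ k, DifferentiableOn ℂ (f k) upperHalf)
    (hm : ∀ k, MapsTo (f k) upperHalf upperHalf) {Y ρ : ℝ} (hY : 0 < Y) (hρ : 0 < ρ)
    (hu : UniformCauchySeqOn f atTop (Metric.ball (Y * I) ρ)) {L : ℂ} (hL : L ∈ upperHalf)
    (hfL : Tendsto (fun k => f k (Y * I)) atTop (𝓝 L)) :
    ∃ F : ℂ → ℂ, DifferentiableOn ℂ F upperHalf ∧ MapsTo F upperHalf upperHalf ∧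
      ∀ z ∈ upperHalf, Tendsto (fun k => f k z) atTop (𝓝 (F z)) := by
  have hymaps : MapsTo (yac Y) (Metric.ball 0 1) upperHalf := fun w hw => yac_im hY (by simpa using hw)
  have hcmaps : MapsTo (cay Y) upperHalf (Metric.ball 0 1) := fun w hw => by
    simpa using norm_cay hY hw
  have hcont : ContinuousAt (yac Y) 0 :=
    (yac_diff.differentiableAt (Metric.ball_mem_nhds 0 one_pos)).continuousAt
  have hy0 : yac Y 0 = Y * I := by simp [yac]
  obtain ⟨δ, hδ, hδb⟩ : ∃ δ > 0, ∀ w, ‖w‖ < δ → yac Y w ∈ Metric.ball (Y * I) ρ := by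
    have := Metric.continuousAt_iff.1 hcont ρ hρ
    simpa [hy0] using this
  set r := min (δ / 2) (1 / 2) with hr
  have hr0 : 0 < r := by positivity
  have hr1 : r < 1 := lt_of_le_of_lt (min_le_right _ _) (by norm_num)
  have hrδ : r < δ := lt_of_le_of_lt (min_le_left _ _) (by linarith)
  obtain ⟨g, hgd, hgt⟩ := vitali_disc (fun k w => cay Y (f k (yac Y w)))
    (fun k => (cay_diff hY).comp ((hd k).comp yac_diff hymaps) ((hm k).comp hymaps))
    (fun k w hw => (norm_cay hY (hm k (hymaps hw))).le) hr0 hr1 (by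
      rw [Metric.uniformCauchySeqOn_iff] at hu ⊢
      intro ε hε
      obtain ⟨N, hN⟩ := hu (ε * Y / 2) (by positivity)
      refine ⟨N, fun m hm' n hn w hw => ?_⟩
      rw [mem_closedBall_zero_iff] at hw
      have hw1 : w ∈ Metric.ball (0:ℂ) 1 := by rw [mem_ball_zero_iff]; linarith
      have := hN m hm' n hn (yac Y w) (hδb w (by linarith))
      rw [dist_eq_norm] at this ⊢
      refine (cay_sub hY (hm m (hymaps hw1)) (hm n (hymaps hw1))).trans_lt ?_
      calc _ < 2 / Y * (ε * Y / 2) := by gcongr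
        _ = ε := by field_simp)
  have hgb : ∀ w ∈ Metric.ball (0:ℂ) 1, ‖g w‖ ≤ 1 := fun w hw =>
    le_of_tendsto (hgt w hw).norm
      (Eventually.of_forall fun k => (norm_cay hY (hm k (hymaps hw))).le)
  have h0 : (0:ℂ) ∈ Metric.ball (0:ℂ) 1 := by simp
  have hg0 : ‖g 0‖ < 1 := by
    have h1 := hgt 0 h0
    rw [hy0] at h1
    have h2 : Tendsto (fun k => cay Y (f k (Y * I))) atTop (𝓝 (cay Y L)) :=
      (((cay_diff hY).differentiableAt (isOpen_upperHalf.mem_nhds hL)).continuousAt.tendsto).comp hfL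
    rw [tendsto_nhds_unique h1 h2]
    exact norm_cay hY hL
  have hg1 : ∀ w ∈ Metric.ball (0:ℂ) 1, ‖g w‖ < 1 := by
    intro w hw
    refine lt_of_le_of_ne (hgb w hw) fun heq => ?_
    have := Complex.eqOn_of_isPreconnected_of_isMaxOn_norm (convex_ball (0:ℂ) 1).isPreconnected
      Metric.isOpen_ball hgd hw (fun x hx => by simpa [heq] using hgb x hx)
    have h3 := this h0
    simp at h3
    rw [h3, heq] at hg0
    exact lt_irrefl _ hg0
  refine ⟨fun z => yac Y (g (cay Y z)), ?_, ?_, ?_⟩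
  · exact yac_diff.comp (hgd.comp (cay_diff hY) hcmaps) fun z hz => by
      simpa using hg1 _ (hcmaps hz)
  · exact fun z hz => yac_im hY (hg1 _ (hcmaps hz))
  · intro z hz
    have h1 := hgt _ (hcmaps hz)
    simp only [yac_cay hY hz] at h1
    have hc : ContinuousAt (yac Y) (g (cay Y z)) :=
      (yac_diff.differentiableAt (Metric.isOpen_ball.mem_nhds
        (by simpa using hg1 _ (hcmaps hz)))).continuousAt
    refine (hc.tendsto.comp h1).congr fun k => ?_
    exact yac_cay hY (hm k hz)
lemma circleMap_norm (θ : ℝ) : ‖circleMap 0 1 θ‖ = 1 := by simp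

lemma dist_circle {w : ℂ} (θ : ℝ) : 1 - ‖w‖ ≤ ‖circleMap 0 1 θ - w‖ := by
  have := norm_sub_norm_le (circleMap 0 1 θ) w
  rwa [circleMap_norm] at this

/-- Poisson kernel on the circle, as a function of the angle. -/
noncomputable def pk (w : ℂ) (θ : ℝ) : ℝ := poissonKernel 0 w (circleMap 0 1 θ)

lemma pk_eq (w : ℂ) (θ : ℝ) : pk w θ = (1 - ‖w‖ ^ 2) / ‖circleMap 0 1 θ - w‖ ^ 2 := by
  rw [pk, poissonKernel_def, sub_zero, sub_zero, circleMap_norm]; norm_num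

lemma pk_cont {w : ℂ} (hw : ‖w‖ < 1) : Continuous (pk w) := by
  have : pk w = fun θ => (1 - ‖w‖ ^ 2) / ‖circleMap 0 1 θ - w‖ ^ 2 := funext (pk_eq w)
  rw [this]
  refine Continuous.div continuous_const ?_ fun θ => ?_
  · have := continuous_circleMap 0 1
    fun_prop
  · have := dist_circle (w := w) θ
    have : 0 < ‖circleMap 0 1 θ - w‖ := by linarith
    positivity

lemma pk_nonneg {w : ℂ} (hw : ‖w‖ < 1) (θ : ℝ) : 0 ≤ pk w θ := by
  rw [pk_eq]
  have : ‖w‖ ^ 2 ≤ 1 := by nlinarith [norm_nonneg w]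
  exact div_nonneg (by linarith) (by positivity)

lemma pk_bound {w : ℂ} (hw : ‖w‖ < 1) (θ : ℝ) : ‖pk w θ‖ ≤ 1 / (1 - ‖w‖) ^ 2 := by
  rw [Real.norm_of_nonneg (pk_nonneg hw θ), pk_eq]
  have h1 := dist_circle (w := w) θ
  have : 0 < 1 - ‖w‖ := by linarith
  gcongr
  nlinarith [norm_nonneg w]

lemma herglotz (f : ℂ → ℂ) (hf : DifferentiableOn ℂ f (Metric.ball 0 1))
    (him : ∀ w ∈ Metric.ball (0:ℂ) 1, (f w).im ≤ 0) :
    ∃ ν : Measure ℝ, IsFiniteMeasure ν ∧ ∀ w ∈ Metric.ball (0:ℂ) 1,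
      - (f w).im = ∫ θ, pk w θ ∂ν := by
  set r : ℕ → ℝ := fun k => 1 - 1 / ((k : ℝ) + 1) with hr
  have hr1 : ∀ k, r k < 1 := fun k => by
    have : 0 < 1 / ((k : ℝ) + 1) := by positivity
    simp only [hr]; linarith
  have hr0 : ∀ k, 0 ≤ r k := fun k => by
    have : 1 / ((k : ℝ) + 1) ≤ 1 := by
      rw [div_le_one (by positivity)]; linarith [Nat.cast_nonneg (α := ℝ) k]
    simp only [hr]; linarith
  have hrt : Tendsto r atTop (𝓝 1) := by
    have := (tendsto_one_div_add_atTop_nhds_zero_nat (𝕜 := ℝ)).const_sub 1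
    simpa [hr] using this
  have hmem : ∀ k, ∀ w ∈ Metric.closedBall (0:ℂ) 1, (r k : ℂ) * w ∈ Metric.ball (0:ℂ) 1 := by
    intro k w hw
    rw [mem_closedBall_zero_iff] at hw
    rw [mem_ball_zero_iff, norm_mul, Complex.norm_real, Real.norm_of_nonneg (hr0 k)]
    nlinarith [hr0 k, hr1 k, norm_nonneg w]
  have hdc : ∀ k, DiffContOnCl ℂ (fun w => f (r k * w)) (Metric.ball 0 1) := by
    intro k
    have : DifferentiableOn ℂ (fun w => f (r k * w)) (Metric.closedBall 0 1) :=
      hf.comp (by fun_prop) (hmem k)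
    refine DifferentiableOn.diffContOnCl ?_
    rwa [closure_ball _ one_ne_zero]
  have hcirc : ∀ θ, circleMap 0 1 θ ∈ Metric.closedBall (0:ℂ) 1 := fun θ => by
    rw [mem_closedBall_zero_iff, circleMap_norm]
  set d : ℕ → ℝ → ℝ := fun k θ => (2 * Real.pi)⁻¹ * - (f (r k * circleMap 0 1 θ)).im with hdd
  have hd0 : ∀ k θ, 0 ≤ d k θ := fun k θ => by
    have h1 := him _ (hmem k _ (hcirc θ))
    have : 0 ≤ (2 * Real.pi)⁻¹ := by positivity
    exact mul_nonneg this (by linarith)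
  have hdcont : ∀ k, Continuous (d k) := by
    intro k
    have h1 : Continuous fun θ => f (r k * circleMap 0 1 θ) := by
      refine hf.continuousOn.comp_continuous ?_ fun θ => hmem k _ (hcirc θ)
      have := continuous_circleMap 0 1
      fun_prop
    simp only [hdd]
    have := Complex.continuous_im.comp h1
    simp only [Function.comp_def] at this
    fun_prop
  set ν : ℕ → Measure ℝ := fun k =>
    (volume.restrict (Ioc 0 (2 * Real.pi))).withDensity (fun θ => ENNReal.ofReal (d k θ)) with hν
  have hpi : (0:ℝ) ≤ 2 * Real.pi := by positivity
  have hInt : ∀ k, ∀ w ∈ Metric.ball (0:ℂ) 1, ∫ θ, pk w θ ∂(ν k) = - (f (r k * w)).im := by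
    intro k w hw
    have hw' : ‖w‖ < 1 := by simpa using hw
    have h1 := (hdc k).circleAverage_poissonKernel_smul hw
    rw [Real.circleAverage_def] at h1
    have h2 : - (f (r k * w)).im = (2 * Real.pi)⁻¹ *
        ∫ θ in (0:ℝ)..(2 * Real.pi), pk w θ * - (f (r k * circleMap 0 1 θ)).im := by
      rw [← h1]
      simp only [Complex.smul_im, smul_eq_mul]
      rw [intervalIntegral.integral_of_le hpi, intervalIntegral.integral_of_le hpi]
      have h3 := Complex.imCLM.integral_comp_comm (μ := volume.restrict (Ioc 0 (2 * Real.pi)))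
        (φ := fun θ => (poissonKernel 0 w • fun w => f (r k * w)) (circleMap 0 1 θ)) (by
          have hc : Continuous fun θ => (pk w θ : ℂ) * f (r k * circleMap 0 1 θ) := by
            refine (Complex.continuous_ofReal.comp (pk_cont hw')).mul
              (hf.continuousOn.comp_continuous ?_ fun θ => hmem k _ (hcirc θ))
            have := continuous_circleMap 0 1
            fun_prop
          have := (hc.integrableOn_Icc (μ := volume) (a := 0) (b := 2 * Real.pi)).mono_set Ioc_subset_Icc_self
          refine this.congr (Eventually.of_forall fun θ => ?_)
          simp [pk])
      simp only [Complex.imCLM_apply] at h3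
      rw [← h3, ← mul_neg, ← integral_neg]
      congr 2
      ext θ
      simp [pk]
    rw [h2, hν, integral_withDensity_eq_integral_toReal_smul
      (hdcont k).measurable.ennreal_ofReal (by simp),
      intervalIntegral.integral_of_le hpi, ← integral_const_mul]
    congr 1
    ext θ
    rw [ENNReal.toReal_ofReal (hd0 k θ), smul_eq_mul, hdd]
    ring
  have hpk0 : ∀ θ, pk 0 θ = 1 := fun θ => by simp [pk_eq]
  have hfin : ∀ k, IsFiniteMeasure (ν k) := by
    intro k
    refine isFiniteMeasure_withDensity_ofReal ?_
    exact ((hdcont k).integrableOn_Icc (μ := volume) (a := 0) (b := 2 * Real.pi)).mono_set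
      Ioc_subset_Icc_self |>.2
  set N : ℕ → FiniteMeasure ℝ := fun k => ⟨ν k, hfin k⟩ with hN
  set C : NNReal := Real.toNNReal (- (f 0).im) with hC
  have hK := isCompact_setOfPred_finiteMeasure_le_of_isCompact C
    (isCompact_Icc (a := (0:ℝ)) (b := 2 * Real.pi))
  have hNK : ∀ k, N k ∈ {μ : FiniteMeasure ℝ | μ.mass ≤ C ∧ μ (Icc 0 (2 * Real.pi))ᶜ = 0} := by
    intro k
    refine ⟨?_, ?_⟩
    · have h := hInt k 0 (by simp)
      simp only [hpk0, integral_const, smul_eq_mul, mul_one, mul_zero] at h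
      rw [← NNReal.coe_le_coe, hC, ← h, Real.coe_toNNReal _ (by positivity)]
      exact le_of_eq rfl
    · have : ν k (Icc 0 (2 * Real.pi))ᶜ = 0 := by
        refine withDensity_absolutelyContinuous _ _ ?_
        rw [Measure.restrict_apply measurableSet_Icc.compl]
        have : (Icc 0 (2 * Real.pi))ᶜ ∩ Ioc 0 (2 * Real.pi) = ∅ := by
          ext x; simp; intro h1 h2; exact h1 h2.le
        rw [this]; simp
      exact (FiniteMeasure.null_iff_toMeasure_null _ _).2 this
  let U : Ultrafilter ℕ := hyperfilter ℕ
  obtain ⟨ν₀, -, hν₀⟩ := hK.ultrafilter_le_nhds' (U.map N)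
    (Ultrafilter.mem_map.2 (Filter.univ_mem' hNK))
  have hT : Tendsto N U (𝓝 ν₀) := hν₀
  refine ⟨ν₀, inferInstance, fun w hw => ?_⟩
  have hw' : ‖w‖ < 1 := by simpa using hw
  have h1 := (FiniteMeasure.tendsto_iff_forall_integral_tendsto.1 hT)
    (BoundedContinuousFunction.ofNormedAddCommGroup (pk w) (pk_cont hw') _ (pk_bound hw'))
  have h2 : Tendsto (fun k => - (f (r k * w)).im) U (𝓝 (- (f w).im)) := by
    have hU : (U : Filter ℕ) ≤ atTop := Nat.hyperfilter_le_atTop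
    have hc : ContinuousAt f w := (hf.differentiableAt (Metric.isOpen_ball.mem_nhds hw)).continuousAt
    have h3 : Tendsto (fun k => (r k : ℂ) * w) atTop (𝓝 w) := by
      have := (Complex.continuous_ofReal.tendsto 1).comp hrt
      simpa using this.mul_const w
    exact ((Complex.continuous_im.tendsto _).comp (hc.tendsto.comp h3)).neg.mono_left hU
  refine tendsto_nhds_unique h2 (h1.congr fun k => ?_)
  exact hInt k w hw
/-- The real point corresponding to a boundary angle. -/
noncomputable def tt (θ : ℝ) : ℝ := (I * (1 + circleMap 0 1 θ) / (1 - circleMap 0 1 θ)).re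

lemma tt_eq {θ : ℝ} (h : circleMap 0 1 θ ≠ 1) :
    (tt θ : ℂ) * (1 - circleMap 0 1 θ) = I * (1 + circleMap 0 1 θ) := by
  have h1 : 1 - circleMap 0 1 θ ≠ 0 := sub_ne_zero.2 h.symm
  rw [← eq_div_iff h1]
  have hn : (circleMap 0 1 θ).re * (circleMap 0 1 θ).re
      + (circleMap 0 1 θ).im * (circleMap 0 1 θ).im = 1 := by
    rw [← Complex.normSq_apply, Complex.normSq_eq_norm_sq, circleMap_norm]; norm_num
  apply Complex.ext
  · simp [tt]
  · rw [Complex.ofReal_im, Complex.div_im]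
    have h2 : Complex.normSq (1 - circleMap 0 1 θ) ≠ 0 := by simpa using h1
    rw [← sub_div, eq_comm, div_eq_zero_iff]
    left
    simp
    linear_combination -hn

lemma tt_sq {θ : ℝ} (h : circleMap 0 1 θ ≠ 1) :
    1 + tt θ ^ 2 = 4 / ‖circleMap 0 1 θ - 1‖ ^ 2 := by
  have h1 : 1 - circleMap 0 1 θ ≠ 0 := sub_ne_zero.2 h.symm
  have h2 : ((tt θ : ℂ) + I) * (1 - circleMap 0 1 θ) = 2 * I := by
    rw [add_mul, tt_eq h]; ring
  have h3 := congrArg (fun x => ‖x‖ ^ 2) h2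
  simp only [norm_mul, mul_pow] at h3
  have h4 : ‖(tt θ : ℂ) + I‖ ^ 2 = 1 + tt θ ^ 2 := by
    rw [← Complex.normSq_eq_norm_sq, Complex.normSq_apply]; simp; ring
  have h5 : ‖1 - circleMap 0 1 θ‖ ^ 2 ≠ 0 := by
    have := norm_pos_iff.2 h1
    positivity
  rw [norm_sub_rev, eq_div_iff h5, ← h4, h3]
  norm_num

lemma pk_cay_aux {z : ℂ} (hz : z ∈ upperHalf) (θ : ℝ) : pk (cay 1 z) θ =
    4 * z.im / ‖circleMap 0 1 θ * (z + I) - (z - I)‖ ^ 2 := by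
  have hd := cay_den_ne one_pos hz
  simp only [ofReal_one, one_mul] at hd
  have hd' : ‖z + I‖ ≠ 0 := norm_ne_zero_iff.2 hd
  have h1 : 1 - ‖cay 1 z‖ ^ 2 = 4 * z.im / ‖z + I‖ ^ 2 := by
    rw [cay, norm_div, div_pow]
    simp only [ofReal_one, one_mul]
    field_simp
    rw [← Complex.normSq_eq_norm_sq, ← Complex.normSq_eq_norm_sq, Complex.normSq_apply,
      Complex.normSq_apply]
    simp; ring
  have h2 : circleMap 0 1 θ - cay 1 z = (circleMap 0 1 θ * (z + I) - (z - I)) / (z + I) := by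
    rw [cay]; simp only [ofReal_one, one_mul]; field_simp
  rw [pk_eq, h1, h2, norm_div, div_pow]
  field_simp

lemma pk_cay {z : ℂ} (hz : z ∈ upperHalf) {θ : ℝ} (h : circleMap 0 1 θ ≠ 1) :
    pk (cay 1 z) θ = (1 + tt θ ^ 2) * (z.im * ‖(z - (tt θ : ℂ))⁻¹‖ ^ 2) := by
  rw [pk_cay_aux hz, tt_sq h]
  have : circleMap 0 1 θ * (z + I) - (z - I) = (circleMap 0 1 θ - 1) * (z - tt θ) := by
    linear_combination - (tt_eq h)
  rw [this, norm_mul, norm_inv, mul_pow]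
  have h1 := norm_ne_zero_iff.2 (sub_ne hz (tt θ))
  have h2 := norm_ne_zero_iff.2 (sub_ne_zero.2 h)
  field_simp

lemma tt_meas : Measurable tt := by
  have := (continuous_circleMap 0 1).measurable
  unfold tt
  exact Complex.measurable_re.comp (by fun_prop)

/-- Density. -/
noncomputable def dens (θ : ℝ) : ENNReal := 4 * (ENNReal.ofReal (‖circleMap 0 1 θ - 1‖ ^ 2))⁻¹

lemma dens_meas : Measurable dens := by
  have := (continuous_circleMap 0 1).measurable
  unfold dens
  fun_prop

lemma dens_toReal {θ : ℝ} (h : circleMap 0 1 θ ≠ 1) : (dens θ).toReal = 1 + tt θ ^ 2 := by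
  rw [tt_sq h, dens, ENNReal.toReal_mul, ENNReal.toReal_inv, ENNReal.toReal_ofReal (by positivity)]
  simp [div_eq_mul_inv]

lemma dens_lim (θ : ℝ) : Tendsto (fun k : ℕ => ENNReal.ofReal (((k:ℝ) + 1) *
    pk (cay 1 (((k:ℝ) + 1 : ℝ) * I)) θ)) atTop (𝓝 (dens θ)) := by
  have hk : ∀ k : ℕ, ENNReal.ofReal (((k:ℝ) + 1) * pk (cay 1 (((k:ℝ) + 1 : ℝ) * I)) θ)
      = 4 * (ENNReal.ofReal (‖(circleMap 0 1 θ - 1) +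
        (((1 / ((k:ℝ) + 1) : ℝ)) : ℂ) * (circleMap 0 1 θ + 1)‖ ^ 2))⁻¹ := by
    intro k
    set y : ℝ := (k:ℝ) + 1 with hy
    have hy0 : 0 < y := by positivity
    have hz : (y : ℂ) * I ∈ upperHalf := by simpa [upperHalf] using hy0
    have hpos : 0 < ‖(circleMap 0 1 θ - 1) + ((1 / y : ℝ) : ℂ) * (circleMap 0 1 θ + 1)‖ := by
      rw [norm_pos_iff]
      intro h0
      have h1 : (circleMap 0 1 θ) * (1 + ((1 / y : ℝ) : ℂ)) = 1 - ((1 / y : ℝ) : ℂ) := by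
        linear_combination h0
      have h2 := congrArg norm h1
      rw [norm_mul, circleMap_norm, one_mul] at h2
      have h3 : (1 : ℂ) + ((1 / y : ℝ) : ℂ) = ((1 + 1 / y : ℝ) : ℂ) := by push_cast; ring
      have h4 : (1 : ℂ) - ((1 / y : ℝ) : ℂ) = ((1 - 1 / y : ℝ) : ℂ) := by push_cast; ring
      rw [h3, h4, Complex.norm_real, Complex.norm_real, Real.norm_eq_abs, Real.norm_eq_abs] at h2
      have h5 : 0 < 1 / y := by positivity
      rcases abs_eq_abs.1 h2 with h | h <;> linarith
    have hcz : circleMap 0 1 θ * ((y : ℂ) * I + I) - ((y : ℂ) * I - I) =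
        (y : ℂ) * I * ((circleMap 0 1 θ - 1) + ((1 / y : ℝ) : ℂ) * (circleMap 0 1 θ + 1)) := by
      have : (y : ℂ) ≠ 0 := by exact_mod_cast hy0.ne'
      push_cast
      field_simp
      ring
    rw [pk_cay_aux hz, hcz, norm_mul, ← ENNReal.ofReal_inv_of_pos (by positivity)]
    have h4 : (4 : ENNReal) = ENNReal.ofReal 4 := by simp
    rw [h4, ← ENNReal.ofReal_mul (by norm_num)]
    congr 1
    have hn : ‖(y : ℂ) * I‖ = y := by simp [abs_of_pos hy0]
    have hi : ((y : ℂ) * I).im = y := by simp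
    rw [hn, hi, mul_pow]
    field_simp
  simp_rw [hk]
  unfold dens
  refine ENNReal.Tendsto.const_mul ?_ (Or.inr (by simp))
  refine (continuous_inv.tendsto _).comp ((ENNReal.continuous_ofReal.tendsto _).comp ?_)
  have h1 : Tendsto (fun k : ℕ => ((1 / ((k:ℝ) + 1) : ℝ) : ℂ)) atTop (𝓝 ((0:ℝ) : ℂ)) :=
    (Complex.continuous_ofReal.tendsto _).comp (tendsto_one_div_add_atTop_nhds_zero_nat (𝕜 := ℝ))
  have h2 := ((h1.mul_const (circleMap 0 1 θ + 1)).const_add (circleMap 0 1 θ - 1)).norm.pow 2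
  simpa using h2

lemma nevanlinna (G : ℂ → ℂ) (hG : DifferentiableOn ℂ G upperHalf)
    (him : ∀ z ∈ upperHalf, (G z).im ≤ 0) (hb : ∀ z ∈ upperHalf, ‖G z‖ ≤ z.im⁻¹)
    (hlim : Tendsto (fun y : ℝ => (y : ℂ) * I * G (y * I)) atTop (𝓝 1)) :
    ∃ μ : Measure ℝ, IsProbabilityMeasure μ ∧ ∀ z ∈ upperHalf, G z = cauchyG μ z := by
  have hymaps : MapsTo (yac 1) (Metric.ball 0 1) upperHalf :=
    fun w hw => yac_im one_pos (by simpa using hw)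
  obtain ⟨ν, hνf, hν⟩ := herglotz (fun w => G (yac 1 w)) (hG.comp yac_diff hymaps)
    (fun w hw => him _ (hymaps hw))
  have hν' : ∀ z ∈ upperHalf, - (G z).im = ∫ θ, pk (cay 1 z) θ ∂ν := by
    intro z hz
    have := hν (cay 1 z) (by simpa using norm_cay one_pos hz)
    simpa only [yac_cay one_pos hz] using this
  have hmass : ∫⁻ θ, dens θ ∂ν ≤ 1 := by
    have hl : ∀ θ, dens θ = liminf (fun k : ℕ => ENNReal.ofReal (((k:ℝ) + 1) *
      pk (cay 1 (((k:ℝ) + 1 : ℝ) * I)) θ)) atTop := fun θ => (dens_lim θ).liminf_eq.symm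
    simp_rw [hl]
    have hH : ∀ k : ℕ, (((k:ℝ) + 1 : ℝ) : ℂ) * I ∈ upperHalf := fun k => by
      simp [upperHalf]; positivity
    refine (lintegral_liminf_le fun k => ?_).trans ?_
    · exact ((pk_cont (norm_cay one_pos (hH k))).measurable.const_mul _).ennreal_ofReal
    · refine liminf_le_of_le (by isBoundedDefault) fun b hb' => ?_
      obtain ⟨k, hk⟩ := hb'.exists
      refine hk.trans ?_
      have hw := norm_cay one_pos (hH k)
      rw [← ofReal_integral_eq_lintegral_ofReal]
      · rw [integral_const_mul, ← hν' _ (hH k)]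
        have h1 := hb _ (hH k)
        have h2 : ((((k:ℝ) + 1 : ℝ) : ℂ) * I).im = (k:ℝ) + 1 := by simp
        rw [h2] at h1
        have h3 := (Complex.abs_im_le_norm (G ((((k:ℝ) + 1 : ℝ) : ℂ) * I))).trans h1
        have h4 := (neg_le_abs _).trans h3
        have h5 : (0:ℝ) < (k:ℝ) + 1 := by positivity
        refine ENNReal.ofReal_le_one.2 ?_
        calc _ ≤ ((k:ℝ) + 1) * ((k:ℝ) + 1)⁻¹ := by gcongr
          _ = 1 := by field_simp
      · refine Integrable.const_mul ?_ _
        exact Integrable.of_bound (pk_cont hw).aestronglyMeasurable _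
          (Eventually.of_forall (pk_bound hw))
      · exact Eventually.of_forall fun θ => mul_nonneg (by positivity) (pk_nonneg hw θ)
  have hae : ∀ᵐ θ ∂ν, dens θ < ⊤ :=
    ae_lt_top dens_meas (hmass.trans_lt ENNReal.one_lt_top).ne
  have hne : ∀ᵐ θ ∂ν, circleMap 0 1 θ ≠ 1 := by
    filter_upwards [hae] with θ h1 h2
    simp [dens, h2] at h1
  set μ : Measure ℝ := (ν.withDensity dens).map tt with hμ
  have hfin0 : IsFiniteMeasure (ν.withDensity dens) :=
    isFiniteMeasure_withDensity (hmass.trans_lt ENNReal.one_lt_top).ne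
  have hfin : IsFiniteMeasure μ := by rw [hμ]; infer_instance
  have him2 : ∀ z ∈ upperHalf, (G z).im = (cauchyG μ z).im := by
    intro z hz
    rw [im_cauchyG hz, ← neg_inj, neg_neg, hν' z hz, hμ, integral_map tt_meas.aemeasurable,
      integral_withDensity_eq_integral_toReal_smul dens_meas hae]
    · refine integral_congr_ae ?_
      filter_upwards [hne] with θ hθ
      rw [pk_cay hz hθ, dens_toReal hθ, smul_eq_mul]
    · exact (by fun_prop :
        Measurable (fun t : ℝ => z.im * ‖(z - (t : ℂ))⁻¹‖ ^ 2)).aestronglyMeasurable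
  have han : AnalyticOnNhd ℂ (fun z => G z - cauchyG μ z) upperHalf :=
    (hG.sub (differentiableOn_cauchyG μ)).analyticOnNhd isOpen_upperHalf
  have hI : ∀ᶠ y : ℝ in atTop, (y : ℂ) * I ∈ upperHalf := by
    filter_upwards [eventually_gt_atTop 0] with y hy
    simpa [upperHalf] using hy
  have hlim2 := (tendsto_mul_cauchyG μ).comp tendsto_I
  simp only [Function.comp_def] at hlim2
  obtain ⟨c, hc⟩ : ∃ c, ∀ z ∈ upperHalf, G z - cauchyG μ z = c := by
    have := han.eq_const_of_im_eq_const (c₀ := 0)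
      (fun z hz => by simp [him2 z hz]) isOpen_upperHalf ⟨⟨I, by simp [upperHalf]⟩, convex_upperHalf.isPreconnected⟩
    exact this
  have hc0 : c = 0 := by
    have h1 : Tendsto (fun y : ℝ => ((y : ℂ) * I)⁻¹ * ((y : ℂ) * I * G (y * I)
        - (y : ℂ) * I * cauchyG μ (y * I))) atTop (𝓝 (0 * (1 - (μ.real univ : ℂ)))) := by
      refine Tendsto.mul ?_ (hlim.sub hlim2)
      rw [tendsto_zero_iff_norm_tendsto_zero]
      have : Tendsto (fun y : ℝ => |y|⁻¹) atTop (𝓝 0) :=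
        tendsto_inv_atTop_zero.comp tendsto_abs_atTop_atTop
      simpa using this
    rw [zero_mul] at h1
    refine tendsto_nhds_unique (f := fun _ : ℝ => c) (l := atTop) tendsto_const_nhds ?_
    refine h1.congr' ?_
    filter_upwards [hI] with y hy
    have h0 : (y : ℂ) * I ≠ 0 := fun h => by
      rw [h] at hy; simp [upperHalf] at hy
    rw [← mul_sub, hc _ hy, inv_mul_cancel_left₀ h0]
  have heq : ∀ z ∈ upperHalf, G z = cauchyG μ z := fun z hz => by
    have := hc z hz
    rw [hc0] at this
    exact sub_eq_zero.1 this
  refine ⟨μ, ?_, heq⟩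
  have h1 : (μ.real univ : ℂ) = 1 := by
    refine tendsto_nhds_unique hlim2 (hlim.congr' ?_)
    filter_upwards [hI] with y hy
    rw [heq _ hy]
  have h2 : μ.real univ = 1 := by exact_mod_cast h1
  constructor
  have h3 : (μ univ).toReal = 1 := h2
  rw [← ENNReal.ofReal_toReal (measure_ne_top μ univ), h3]
  simp
/-- The fixed point map. -/
noncomputable def TT {n : ℕ} (μ : Fin n → Measure ℝ) (z : ℂ) (Z : Fin n → ℂ) (i : Fin n) : ℂ :=
  z + ∑ j ∈ Finset.univ.erase i, hh (μ j) (Z j)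

/-- A height at which the fixed point map is a contraction. -/
def Good {n : ℕ} (μ : Fin n → Measure ℝ) (y : ℝ) : Prop :=
  0 < y ∧ (∀ j, ∀ w ∈ Metric.closedBall ((y : ℂ) * I) (y / 4),
      ‖hh (μ j) w‖ ≤ 1 / (16 * ((n : ℝ) + 1)) * y) ∧
    ∀ j, ∀ a ∈ Metric.closedBall ((y : ℂ) * I) (y / 4),
      ∀ b ∈ Metric.closedBall ((y : ℂ) * I) (y / 4),
        ‖hh (μ j) a - hh (μ j) b‖ ≤ 1 / (2 * ((n : ℝ) + 1)) * ‖a - b‖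

lemma im_ball {y r : ℝ} {w : ℂ} (h : ‖w - (y : ℂ) * I‖ ≤ r) :
    y - r ≤ w.im ∧ w.im ≤ y + r ∧ ‖w‖ ≤ |y| + r := by
  have h1 := (Complex.abs_im_le_norm (w - (y : ℂ) * I)).trans h
  have h2 : (w - (y : ℂ) * I).im = w.im - y := by simp
  rw [h2, abs_le] at h1
  refine ⟨by linarith, by linarith, ?_⟩
  have h3 : ‖(y : ℂ) * I‖ = |y| := by simp
  have h4 := norm_add_le ((y : ℂ) * I) (w - (y : ℂ) * I)
  rw [add_sub_cancel, h3] at h4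
  linarith

lemma eventually_good {n : ℕ} (μ : Fin n → Measure ℝ) (hμ : ∀ i, IsProbabilityMeasure (μ i)) :
    ∀ᶠ y : ℝ in atTop, Good μ y := by
  set δ : ℝ := 1 / (16 * ((n : ℝ) + 1)) with hδ
  have hn0 : (0:ℝ) < (n : ℝ) + 1 := by positivity
  have hδ0 : 0 < δ := by positivity
  have h1 : ∀ᶠ z in ntInf, ∀ j, ‖hh (μ j) z‖ ≤ (2 / 3 * δ) * z.im :=
    eventually_all.2 fun j => by
      haveI := hμ j
      exact hh_small (μ j) (by positivity)
  rw [ntInf, eventually_inf_principal, eventually_comap] at h1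
  obtain ⟨Y, hY⟩ := eventually_atTop.1 h1
  filter_upwards [eventually_gt_atTop 0, eventually_ge_atTop (2 * Y)] with y hy0 hyY
  have key : ∀ j, ∀ w, ‖w - (y : ℂ) * I‖ ≤ y / 2 → ‖hh (μ j) w‖ ≤ δ * y := by
    intro j w hw
    obtain ⟨ha, hb, hc⟩ := im_ball hw
    rw [abs_of_pos hy0] at hc
    have := hY w.im (by linarith) w rfl (show ‖w‖ ≤ 3 * w.im by linarith) j
    refine this.trans ?_
    nlinarith
  refine ⟨hy0, fun j w hw => key j w ?_, fun j a ha b hb => ?_⟩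
  · rw [mem_closedBall_iff_norm] at hw; linarith
  · haveI := hμ j
    have hmem : ∀ w, ‖w - (y : ℂ) * I‖ ≤ y / 2 → w ∈ upperHalf := fun w hw => by
      have := (im_ball hw).1
      show 0 < w.im
      linarith
    refine Convex.norm_image_sub_le_of_norm_deriv_le (𝕜 := ℂ) (f := hh (μ j))
      (s := Metric.closedBall ((y : ℂ) * I) (y / 4)) ?_ ?_ (convex_closedBall _ _) hb ha
    · intro x hx
      rw [mem_closedBall_iff_norm] at hx
      exact (hh_diff (μ j)).differentiableAt
        (isOpen_upperHalf.mem_nhds (hmem x (by linarith)))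
    · intro x hx
      rw [mem_closedBall_iff_norm] at hx
      have hin : ∀ w ∈ Metric.closedBall x (y / 8), ‖w - (y : ℂ) * I‖ ≤ y / 2 := by
        intro w hw
        rw [mem_closedBall_iff_norm] at hw
        have := norm_sub_le_norm_sub_add_norm_sub w x ((y : ℂ) * I)
        linarith
      have := Complex.norm_deriv_le_of_forall_mem_sphere_norm_le (f := hh (μ j)) (c := x)
        (R := y / 8) (C := δ * y) (by positivity) ?_ ?_
      · refine this.trans (le_of_eq ?_)
        rw [hδ]; field_simp; norm_num
      · refine DifferentiableOn.diffContOnCl ?_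
        refine (hh_diff (μ j)).mono fun w hw => hmem w (hin w ?_)
        rwa [closure_ball _ (by positivity)] at hw
      · exact fun w hw => key j w (hin w (Metric.sphere_subset_closedBall hw))

lemma Good.maps {n : ℕ} {μ : Fin n → Measure ℝ} {y : ℝ} (h : Good μ y) {z : ℂ}
    (hz : ‖z - (y : ℂ) * I‖ ≤ y / 8) {Z : Fin n → ℂ}
    (hZ : ∀ i, Z i ∈ Metric.closedBall ((y : ℂ) * I) (y / 4)) (i : Fin n) :
    TT μ z Z i ∈ Metric.closedBall ((y : ℂ) * I) (y / 4) := by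
  obtain ⟨hy, h1, -⟩ := h
  rw [mem_closedBall_iff_norm, TT]
  have hn0 : (0:ℝ) < (n : ℝ) + 1 := by positivity
  have h2 : ‖∑ j ∈ Finset.univ.erase i, hh (μ j) (Z j)‖ ≤ y / 16 := by
    calc _ ≤ ∑ j ∈ Finset.univ.erase i, ‖hh (μ j) (Z j)‖ := norm_sum_le _ _
      _ ≤ ∑ j, ‖hh (μ j) (Z j)‖ :=
        Finset.sum_le_sum_of_subset_of_nonneg (Finset.erase_subset _ _) (fun _ _ _ => norm_nonneg _)
      _ ≤ ∑ j : Fin n, 1 / (16 * ((n : ℝ) + 1)) * y := Finset.sum_le_sum fun j _ => h1 j _ (hZ j)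
      _ = (n : ℝ) / ((n : ℝ) + 1) * (y / 16) := by
        simp; field_simp
      _ ≤ 1 * (y / 16) := by
        gcongr
        rw [div_le_one hn0]; linarith
      _ = y / 16 := one_mul _
  have h3 := norm_add_le (z - (y : ℂ) * I) (∑ j ∈ Finset.univ.erase i, hh (μ j) (Z j))
  rw [show z + ∑ j ∈ Finset.univ.erase i, hh (μ j) (Z j) - (y : ℂ) * I
    = (z - (y : ℂ) * I) + ∑ j ∈ Finset.univ.erase i, hh (μ j) (Z j) by ring]
  linarith

lemma Good.contr {n : ℕ} {μ : Fin n → Measure ℝ} {y : ℝ} (h : Good μ y) {z : ℂ}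
    {Z W : Fin n → ℂ} (hZ : ∀ i, Z i ∈ Metric.closedBall ((y : ℂ) * I) (y / 4))
    (hW : ∀ i, W i ∈ Metric.closedBall ((y : ℂ) * I) (y / 4)) :
    ‖TT μ z Z - TT μ z W‖ ≤ 1 / 2 * ‖Z - W‖ := by
  obtain ⟨hy, -, h1⟩ := h
  have hn0 : (0:ℝ) < (n : ℝ) + 1 := by positivity
  refine (pi_norm_le_iff_of_nonneg (by positivity)).2 fun i => ?_
  rw [Pi.sub_apply, TT, TT, add_sub_add_left_eq_sub, ← Finset.sum_sub_distrib]
  calc _ ≤ ∑ j ∈ Finset.univ.erase i, ‖hh (μ j) (Z j) - hh (μ j) (W j)‖ := norm_sum_le _ _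
    _ ≤ ∑ j, ‖hh (μ j) (Z j) - hh (μ j) (W j)‖ :=
      Finset.sum_le_sum_of_subset_of_nonneg (Finset.erase_subset _ _) (fun _ _ _ => norm_nonneg _)
    _ ≤ ∑ j : Fin n, 1 / (2 * ((n : ℝ) + 1)) * ‖Z - W‖ := by
      refine Finset.sum_le_sum fun j _ => (h1 j _ (hZ j) _ (hW j)).trans ?_
      gcongr
      exact norm_le_pi_norm (Z - W) j
    _ = (n : ℝ) / ((n : ℝ) + 1) * (1 / 2 * ‖Z - W‖) := by
      simp; field_simp
    _ ≤ 1 * (1 / 2 * ‖Z - W‖) := by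
      gcongr
      rw [div_le_one hn0]; linarith
    _ = _ := one_mul _

lemma Good.eq {n : ℕ} {μ : Fin n → Measure ℝ} {y : ℝ} (h : Good μ y) {z : ℂ}
    {Z W : Fin n → ℂ} (hZ : ∀ i, Z i ∈ Metric.closedBall ((y : ℂ) * I) (y / 4))
    (hW : ∀ i, W i ∈ Metric.closedBall ((y : ℂ) * I) (y / 4))
    (hZf : ∀ i, Z i = TT μ z Z i) (hWf : ∀ i, W i = TT μ z W i) : Z = W := by
  have h1 := h.contr (z := z) hZ hW
  rw [← funext hZf, ← funext hWf] at h1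
  have h2 : ‖Z - W‖ = 0 := le_antisymm (by linarith) (norm_nonneg _)
  exact sub_eq_zero.1 (norm_eq_zero.1 h2)

/-- Iterates. -/
noncomputable def ZZ {n : ℕ} (μ : Fin n → Measure ℝ) : ℕ → ℂ → Fin n → ℂ
  | 0, z => fun _ => z
  | k + 1, z => TT μ z (ZZ μ k z)

lemma TT_im {n : ℕ} (μ : Fin n → Measure ℝ) (hμ : ∀ i, IsProbabilityMeasure (μ i)) {z : ℂ}
    {Z : Fin n → ℂ} (hZ : ∀ i, Z i ∈ upperHalf) (i : Fin n) : z.im ≤ (TT μ z Z i).im := by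
  rw [TT, Complex.add_im, Complex.im_sum]
  refine le_add_of_nonneg_right (Finset.sum_nonneg fun j _ => ?_)
  haveI := hμ j
  exact hh_im (hZ j)

lemma ZZ_im {n : ℕ} (μ : Fin n → Measure ℝ) (hμ : ∀ i, IsProbabilityMeasure (μ i)) {z : ℂ}
    (hz : z ∈ upperHalf) (k : ℕ) : ∀ i, z.im ≤ (ZZ μ k z i).im := by
  induction k with
  | zero => intro i; exact le_rfl
  | succ k ih => exact TT_im μ hμ fun j => lt_of_lt_of_le (show 0 < z.im from hz) (ih j)

lemma ZZ_diff {n : ℕ} (μ : Fin n → Measure ℝ) (hμ : ∀ i, IsProbabilityMeasure (μ i)) (k : ℕ) :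
    ∀ i, DifferentiableOn ℂ (fun z => ZZ μ k z i) upperHalf := by
  induction k with
  | zero => intro i; exact differentiableOn_id
  | succ k ih =>
    intro i
    simp only [ZZ, TT]
    refine differentiableOn_id.add (DifferentiableOn.fun_sum fun j _ => ?_)
    haveI := hμ j
    exact (hh_diff (μ j)).comp (ih j)
      fun z hz => lt_of_lt_of_le (show 0 < z.im from hz) (ZZ_im μ hμ hz k j)

lemma ZZ_mem {n : ℕ} {μ : Fin n → Measure ℝ} {y : ℝ} (h : Good μ y) {z : ℂ}
    (hz : ‖z - (y : ℂ) * I‖ ≤ y / 8) (k : ℕ) :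
    ∀ i, ZZ μ k z i ∈ Metric.closedBall ((y : ℂ) * I) (y / 4) := by
  induction k with
  | zero =>
    intro i
    have := h.1
    rw [mem_closedBall_iff_norm]
    show ‖z - (y : ℂ) * I‖ ≤ _
    linarith
  | succ k ih => exact h.maps hz ih

lemma ZZ_step {n : ℕ} {μ : Fin n → Measure ℝ} {y : ℝ} (h : Good μ y) {z : ℂ}
    (hz : ‖z - (y : ℂ) * I‖ ≤ y / 8) (k : ℕ) :
    ‖ZZ μ k z - ZZ μ (k + 1) z‖ ≤ y / 2 * (1 / 2) ^ k := by
  induction k with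
  | zero =>
    have h0 := ZZ_mem h hz 0
    have h1 := ZZ_mem h hz 1
    have hy := h.1
    refine (pi_norm_le_iff_of_nonneg (by positivity)).2 fun i => ?_
    have h2 := h0 i
    have h3 := h1 i
    rw [mem_closedBall_iff_norm] at h2 h3
    have := norm_sub_le_norm_sub_add_norm_sub (ZZ μ 0 z i) ((y : ℂ) * I) (ZZ μ 1 z i)
    rw [norm_sub_rev ((y : ℂ) * I)] at this
    simp only [Pi.sub_apply, pow_zero]
    norm_num
    linarith
  | succ k ih =>
    have := h.contr (z := z) (ZZ_mem h hz k) (ZZ_mem h hz (k + 1))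
    refine le_trans this ?_
    rw [pow_succ]
    linarith

lemma ZZ_dist {n : ℕ} {μ : Fin n → Measure ℝ} {y : ℝ} (h : Good μ y) {z : ℂ}
    (hz : ‖z - (y : ℂ) * I‖ ≤ y / 8) (i : Fin n) (k : ℕ) :
    dist (ZZ μ k z i) (ZZ μ (k + 1) z i) ≤ y / 2 * (1 / 2) ^ k := by
  rw [dist_eq_norm]
  exact (norm_le_pi_norm (ZZ μ k z - ZZ μ (k + 1) z) i).trans (ZZ_step h hz k)

lemma ZZ_cauchy {n : ℕ} {μ : Fin n → Measure ℝ} {y : ℝ} (h : Good μ y) (i : Fin n) :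
    UniformCauchySeqOn (fun k z => ZZ μ k z i) atTop (Metric.ball ((y : ℂ) * I) (y / 8)) := by
  have hz : ∀ z ∈ Metric.ball ((y : ℂ) * I) (y / 8), ‖z - (y : ℂ) * I‖ ≤ y / 8 :=
    fun z hz => (mem_ball_iff_norm.1 hz).le
  have hs : ∀ z ∈ Metric.ball ((y : ℂ) * I) (y / 8), CauchySeq (fun k => ZZ μ k z i) :=
    fun z hz' => cauchySeq_of_le_geometric _ _ (by norm_num) (ZZ_dist h (hz z hz') i)
  choose! L hL using fun z hz' => cauchySeq_tendsto_of_complete (hs z hz')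
  refine TendstoUniformlyOn.uniformCauchySeqOn (f := L) ?_
  rw [Metric.tendstoUniformlyOn_iff]
  intro ε hε
  have ht : Tendsto (fun k : ℕ => y / 2 * (1 / 2 : ℝ) ^ k / (1 - 1 / 2)) atTop (𝓝 0) := by
    have := ((tendsto_pow_atTop_nhds_zero_of_lt_one (r := (1 / 2 : ℝ)) (by norm_num)
      (by norm_num)).const_mul (y / 2)).div_const (1 - 1 / 2)
    simpa using this
  filter_upwards [ht.eventually_lt_const hε] with k hk z hz'
  rw [dist_comm]
  exact lt_of_le_of_lt (dist_le_of_le_geometric_of_tendsto _ _ (by norm_num)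
    (ZZ_dist h (hz z hz') i) (hL z hz') k) hk

/-- Existence of the fixed points. -/
lemma exists_fixed {n : ℕ} (μ : Fin n → Measure ℝ) (hμ : ∀ i, IsProbabilityMeasure (μ i)) :
    ∃ Z : Fin n → ℂ → ℂ, (∀ i, DifferentiableOn ℂ (Z i) upperHalf) ∧
      (∀ i, ∀ z ∈ upperHalf, z.im ≤ (Z i z).im) ∧
      (∀ i, ∀ z ∈ upperHalf, Z i z = TT μ z (fun j => Z j z) i) ∧
      (∀ y, Good μ y → ∀ i, Z i (y * I) ∈ Metric.closedBall ((y : ℂ) * I) (y / 4)) := by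
  obtain ⟨Y, hY⟩ := (eventually_good μ hμ).exists
  have hY0 := hY.1
  have hYb : ∀ y : ℝ, 0 < y → ‖(y : ℂ) * I - (y : ℂ) * I‖ ≤ y / 8 := fun y hy => by
    simp; positivity
  have hex : ∀ i, ∃ F : ℂ → ℂ, DifferentiableOn ℂ F upperHalf ∧ MapsTo F upperHalf upperHalf ∧
      ∀ z ∈ upperHalf, Tendsto (fun k => ZZ μ k z i) atTop (𝓝 (F z)) := by
    intro i
    obtain ⟨L, hL⟩ := cauchySeq_tendsto_of_complete
      (cauchySeq_of_le_geometric _ _ (by norm_num) (ZZ_dist hY (hYb Y hY0) i))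
    have hLm : L ∈ Metric.closedBall ((Y : ℂ) * I) (Y / 4) :=
      Metric.isClosed_closedBall.mem_of_tendsto hL
        (Eventually.of_forall fun k => ZZ_mem hY (hYb Y hY0) k i)
    refine vitali_half (fun k z => ZZ μ k z i) (fun k => ZZ_diff μ hμ k i)
      (fun k z hz => lt_of_lt_of_le (show 0 < z.im from hz) (ZZ_im μ hμ hz k i)) hY0
      (by positivity : 0 < Y / 8) (ZZ_cauchy hY i) (L := L) ?_ hL
    have := (im_ball (mem_closedBall_iff_norm.1 hLm)).1
    show 0 < L.im
    linarith
  choose Z hZd hZm hZt using hex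
  refine ⟨Z, hZd, fun i z hz => ?_, fun i z hz => ?_, fun y hy i => ?_⟩
  · exact ge_of_tendsto ((Complex.continuous_im.tendsto _).comp (hZt i z hz))
      (Eventually.of_forall fun k => ZZ_im μ hμ hz k i)
  · have h1 := (hZt i z hz).comp (tendsto_add_atTop_nat 1)
    refine tendsto_nhds_unique h1 ?_
    show Tendsto (fun k => z + ∑ j ∈ Finset.univ.erase i, hh (μ j) (ZZ μ k z j)) atTop _
    refine tendsto_const_nhds.add (tendsto_finsetSum _ fun j _ => ?_)
    haveI := hμ j
    exact (((hh_diff (μ j)).differentiableAt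
      (isOpen_upperHalf.mem_nhds (hZm j hz))).continuousAt.tendsto).comp (hZt j z hz)
  · have hm : (y : ℂ) * I ∈ upperHalf := by simpa [upperHalf] using hy.1
    exact Metric.isClosed_closedBall.mem_of_tendsto (hZt i _ hm)
        (Eventually.of_forall fun k => ZZ_mem hy (hYb y hy.1) k i)

lemma classF_of {n : ℕ} (μ : Fin n → Measure ℝ) (hμ : ∀ i, IsProbabilityMeasure (μ i))
    (Z : Fin n → ℂ → ℂ) (hd : ∀ i, DifferentiableOn ℂ (Z i) upperHalf)
    (him : ∀ i, ∀ z ∈ upperHalf, z.im ≤ (Z i z).im)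
    (hf : ∀ i, ∀ z ∈ upperHalf, Z i z = TT μ z (fun j => Z j z) i)
    (hg : ∀ y, Good μ y → ∀ i, Z i (y * I) ∈ Metric.closedBall ((y : ℂ) * I) (y / 4))
    (i : Fin n) : classF (Z i) := by
  have hpos : ∀ z ∈ upperHalf, 0 < (Z i z).im := fun z hz =>
    lt_of_lt_of_le (show 0 < z.im from hz) (him i z hz)
  have hne : ∀ z ∈ upperHalf, Z i z ≠ 0 := fun z hz h => by
    have := hpos z hz
    rw [h] at this; simp at this
  have hnt : ∀ j, Tendsto (fun y : ℝ => Z j (y * I)) atTop ntInf := by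
    intro j
    rw [ntInf, tendsto_inf, tendsto_comap_iff, tendsto_principal]
    constructor
    · refine tendsto_atTop_mono' _ ?_ tendsto_id
      filter_upwards [eventually_gt_atTop 0] with y hy
      have := him j ((y : ℂ) * I) (by simpa [upperHalf] using hy)
      simpa using this
    · filter_upwards [eventually_good μ hμ] with y hy
      obtain ⟨h1, h2, h3⟩ := im_ball (mem_closedBall_iff_norm.1 (hg y hy j))
      have := hy.1
      rw [abs_of_pos this] at h3
      show _ ≤ _
      linarith
  have hterm : ∀ j, Tendsto (fun y : ℝ => ((y : ℂ) * I)⁻¹ * hh (μ j) (Z j (y * I)))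
      atTop (𝓝 0) := by
    intro j
    haveI := hμ j
    rw [Metric.tendsto_nhds]
    intro ε hε
    filter_upwards [(hnt j).eventually (hh_small (μ j) (half_pos (half_pos hε))),
      eventually_good μ hμ] with y h1 hy
    have hy0 := hy.1
    obtain ⟨-, h2, -⟩ := im_ball (mem_closedBall_iff_norm.1 (hg y hy j))
    rw [dist_zero_right, norm_mul, norm_inv]
    have : ‖(y : ℂ) * I‖ = y := by simp [abs_of_pos hy0]
    rw [this, inv_mul_lt_iff₀ hy0]
    nlinarith [mul_pos hε hy0, mul_le_mul_of_nonneg_left h2 hε.le]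
  have hq : Tendsto (fun y : ℝ => ((y : ℂ) * I)⁻¹ * Z i (y * I)) atTop (𝓝 1) := by
    have h1 : Tendsto (fun y : ℝ => 1 + ∑ j ∈ Finset.univ.erase i,
        ((y : ℂ) * I)⁻¹ * hh (μ j) (Z j (y * I))) atTop
        (𝓝 (1 + ∑ j ∈ Finset.univ.erase i, 0)) :=
      tendsto_const_nhds.add (tendsto_finsetSum _ fun j _ => hterm j)
    simp only [Finset.sum_const_zero, add_zero] at h1
    refine h1.congr' ?_
    filter_upwards [eventually_gt_atTop 0] with y hy
    have h0 : (y : ℂ) * I ≠ 0 := by simp [hy.ne']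
    rw [hf i ((y : ℂ) * I) (by simpa [upperHalf] using hy), TT, mul_add, inv_mul_cancel₀ h0,
      Finset.mul_sum]
  have hi : ∀ z ∈ upperHalf, ((Z i z)⁻¹).im ≤ 0 := by
    intro z hz
    rw [Complex.inv_im]
    exact div_nonpos_of_nonpos_of_nonneg (by linarith [hpos z hz]) (Complex.normSq_nonneg _)
  have hb : ∀ z ∈ upperHalf, ‖(Z i z)⁻¹‖ ≤ z.im⁻¹ := by
    intro z hz
    rw [norm_inv]
    refine inv_anti₀ hz ((him i z hz).trans ?_)
    exact (le_abs_self _).trans (Complex.abs_im_le_norm _)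
  have hl : Tendsto (fun y : ℝ => (y : ℂ) * I * (Z i (y * I))⁻¹) atTop (𝓝 1) := by
    have := hq.inv₀ one_ne_zero
    simpa only [mul_inv, inv_inv, inv_one] using this
  obtain ⟨ρ, hρ, hρ_eq⟩ := nevanlinna (fun z => (Z i z)⁻¹) ((hd i).fun_inv hne) hi hb hl
  refine ⟨ρ, hρ, fun z hz => ?_⟩
  rw [recF, ← hρ_eq z hz, inv_inv]

lemma recF_eq (μ : Measure ℝ) (z : ℂ) : recF μ z = z + hh μ z := by
  rw [hh]; ring

lemma TT_add {n : ℕ} (μ : Fin n → Measure ℝ) (z : ℂ) (Z : Fin n → ℂ) (i : Fin n) :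
    TT μ z Z i + hh (μ i) (Z i) = z + ∑ j, hh (μ j) (Z j) := by
  rw [TT, ← Finset.sum_erase_add _ _ (Finset.mem_univ i), add_assoc]
end AddSub

/-- Corollary 2.2: subordination functions for n probability measures. -/
theorem additive_subordination_multi (n : ℕ) (hn : 2 ≤ n)
    (μ : Fin n → Measure ℝ) (hμ : ∀ i, IsProbabilityMeasure (μ i)) :
    ∃ Z : Fin n → ℂ → ℂ, (∀ i, classF (Z i)) ∧
      (∀ z ∈ upperHalf,
        z = (∑ i, Z i z) -
            ((n : ℂ) - 1) * recF (μ ⟨0, by omega⟩) (Z ⟨0, by omega⟩ z) ∧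
        ∀ i, recF (μ i) (Z i z) = recF (μ ⟨0, by omega⟩) (Z ⟨0, by omega⟩ z)) ∧
      (∀ W : Fin n → ℂ → ℂ, (∀ i, classF (W i)) →
        (∀ z ∈ upperHalf,
          z = (∑ i, W i z) -
              ((n : ℂ) - 1) * recF (μ ⟨0, by omega⟩) (W ⟨0, by omega⟩ z) ∧
          ∀ i, recF (μ i) (W i z) = recF (μ ⟨0, by omega⟩) (W ⟨0, by omega⟩ z)) →
        ∀ i, ∀ z ∈ upperHalf, W i z = Z i z) := by
  obtain ⟨Z, hd, him, hf, hg⟩ := AddSub.exists_fixed μ hμ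
  refine ⟨Z, AddSub.classF_of μ hμ Z hd him hf hg, fun z hz => ?_, fun W hWc hW i => ?_⟩
  · have hr : ∀ i, recF (μ i) (Z i z) = z + ∑ j, AddSub.hh (μ j) (Z j z) := fun i => by
      rw [AddSub.recF_eq, ← AddSub.TT_add μ z (fun j => Z j z) i, ← hf i z hz]
    refine ⟨?_, fun i => by rw [hr, hr]⟩
    rw [hr]
    have hs : ∑ i, (Z i z + AddSub.hh (μ i) (Z i z))
        = ∑ i : Fin n, (z + ∑ j, AddSub.hh (μ j) (Z j z)) :=
      Finset.sum_congr rfl fun i _ => by rw [← AddSub.recF_eq, hr]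
    rw [Finset.sum_add_distrib, Finset.sum_const, Finset.card_univ, Fintype.card_fin,
      nsmul_eq_mul] at hs
    linear_combination -hs
  · choose ρ hρ hρW using hWc
    have hWf : ∀ i, ∀ z ∈ upperHalf, W i z = AddSub.TT μ z (fun j => W j z) i := by
      intro i z hz
      obtain ⟨h1, h2⟩ := hW z hz
      set w := recF (μ ⟨0, by omega⟩) (W ⟨0, by omega⟩ z) with hw
      have hs : ∑ i, (W i z + AddSub.hh (μ i) (W i z)) = ∑ i : Fin n, w :=
        Finset.sum_congr rfl fun i _ => by rw [← AddSub.recF_eq, h2]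
      rw [Finset.sum_add_distrib, Finset.sum_const, Finset.card_univ, Fintype.card_fin,
        nsmul_eq_mul] at hs
      have h3 := AddSub.TT_add μ z (fun j => W j z) i
      have h4 := h2 i
      rw [AddSub.recF_eq] at h4
      linear_combination h4 - h3 - h1 - hs
    have hWd : ∀ i, DifferentiableOn ℂ (W i) upperHalf := fun i => by
      haveI := hρ i
      exact (AddSub.differentiableOn_recF (ρ i)).congr (hρW i)
    have hev : ∀ᶠ y : ℝ in atTop, ∀ i, W i (y * I) = Z i (y * I) := by
      have h1 : ∀ᶠ y : ℝ in atTop, ∀ i, ‖AddSub.hh (ρ i) (y * I)‖ ≤ 1 / 4 * ((y : ℂ) * I).im :=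
        eventually_all.2 fun i => by
          haveI := hρ i
          exact AddSub.tendsto_I.eventually (AddSub.hh_small (ρ i) (by norm_num))
      filter_upwards [h1, AddSub.eventually_good μ hμ] with y hy hgood
      have hm : (y : ℂ) * I ∈ upperHalf := by simpa [upperHalf] using hgood.1
      refine congrFun (hgood.eq (z := (y : ℂ) * I) (fun i => ?_) (hg y hgood)
        (fun i => hWf i _ hm) (fun i => hf i _ hm))
      rw [mem_closedBall_iff_norm, hρW i _ hm]
      have := hy i
      rw [AddSub.hh] at this
      simp only [mul_im, ofReal_re, I_im, mul_one, ofReal_im, I_re, mul_zero, add_zero] at this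
      linarith
    obtain ⟨Y, hY⟩ := eventually_atTop.1 (hev.and (eventually_gt_atTop 0))
    have hYm : (Y : ℂ) * I ∈ upperHalf := by simpa [upperHalf] using (hY Y le_rfl).2
    have ht : Tendsto (fun y : ℝ => (y : ℂ) * I) (nhdsWithin Y (Ioi Y))
        (nhdsWithin ((Y : ℂ) * I) {(Y : ℂ) * I}ᶜ) := by
      refine tendsto_nhdsWithin_iff.2 ⟨?_, ?_⟩
      · exact ((by fun_prop : Continuous fun y : ℝ => (y : ℂ) * I).tendsto Y).mono_left
          nhdsWithin_le_nhds
      · filter_upwards [self_mem_nhdsWithin] with y hy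
        have : y ≠ Y := (ne_of_gt hy)
        simpa using this
    have hfr : ∃ᶠ w in nhdsWithin ((Y : ℂ) * I) {(Y : ℂ) * I}ᶜ, W i w = Z i w := by
      refine ht.frequently (Eventually.frequently ?_)
      filter_upwards [self_mem_nhdsWithin] with y hy
      exact (hY y (le_of_lt hy)).1 i
    exact ((hWd i).analyticOnNhd AddSub.isOpen_upperHalf).eqOn_of_preconnected_of_frequently_eq
      ((hd i).analyticOnNhd AddSub.isOpen_upperHalf) AddSub.convex_upperHalf.isPreconnected hYm hfr
end
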